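/- arXiv:1806.03755 — 8 statements merged into one kernel-verified Lean document; each statement's English description precedes it below -/
import Mathlib

section
/- Let d ≥ 1, let Γ be a symmetric positive definite d×d real matrix with spectral norm ‖Γ‖, let μ ∈ ℝ^d satisfy μ_i < 0 for all 1 ≤ i ≤ d, and let u be an admissible potential derivative. Then for every ε > 0 there exist a constant b < ∞, a radius r > 0, and a norm-like function V : ℝ^d → [1, ∞) such that for all x ∈ ℝ^d, 𝓛V(x) ≤ −(1/(2d‖Γ‖))·(min_{1≤i≤d} μ_i² − ε)·V(x) + b·1_{{‖x‖ ≤ r}}(x). -/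
open Filter Real Set

noncomputable section

/-- A function `u : ℝ → ℝ` is an admissible potential derivative. -/
def Admissible (u : ℝ → ℝ) : Prop :=
  Continuous u ∧ (∀ y, 0 ≤ u y) ∧ AntitoneOn u (Set.Iic 0) ∧
  Tendsto u atTop (nhds 0) ∧ Tendsto u atBot atTop ∧
  ∀ a b : ℝ, 0 < b → b < a → Tendsto (fun y => u (a * y) / u (b * y)) atBot atTop

/-- The drift coefficient `μ i + u (x i) - u (x (i-1))`, with the convention `u (x 0) = 0`
(indices are 0-based: the coefficient for the first coordinate has no `u (x (i-1))` term). -/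
def driftCoeff {d : ℕ} (μ : Fin d → ℝ) (u : ℝ → ℝ) (x : EuclideanSpace ℝ (Fin d))
    (i : Fin d) : ℝ :=
  μ i + u (x i) - (if (i : ℕ) = 0 then 0 else u (x ⟨(i : ℕ) - 1, lt_of_le_of_lt (Nat.sub_le _ _) i.isLt⟩))

/-- The generator 𝓛 of the GRBM with tridiagonal reflection structure. -/
def generator {d : ℕ} (Γ : Matrix (Fin d) (Fin d) ℝ) (μ : Fin d → ℝ) (u : ℝ → ℝ)
    (f : EuclideanSpace ℝ (Fin d) → ℝ) (x : EuclideanSpace ℝ (Fin d)) : ℝ :=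
  (1/2) * ∑ i, ∑ j, Γ i j *
      fderiv ℝ (fun y => fderiv ℝ f y (EuclideanSpace.single j (1:ℝ))) x
        (EuclideanSpace.single i (1:ℝ))
    + ∑ i, driftCoeff μ u x i * fderiv ℝ f x (EuclideanSpace.single i (1:ℝ))

/-- A function `V` is norm-like: `V ≥ 1`, twice continuously differentiable, and
`V x → ∞` as `‖x‖ → ∞`. -/
def NormLike {d : ℕ} (V : EuclideanSpace ℝ (Fin d) → ℝ) : Prop :=
  (∀ x, 1 ≤ V x) ∧ ContDiff ℝ 2 V ∧ Tendsto V (Filter.comap norm Filter.atTop) Filter.atTop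

/-- A twice continuously differentiable substitute for the positive part. -/
def smoothPos (t : ℝ) : ℝ := max t 0 - Real.arctan (max t 0)

/-- The derivative of `smoothPos`. -/
def smoothPosDeriv (t : ℝ) : ℝ := max t 0 ^ 2 / (1 + max t 0 ^ 2)

/-- The second derivative of `smoothPos`. -/
def smoothPosDeriv₂ (t : ℝ) : ℝ := 2 * max t 0 / (1 + max t 0 ^ 2) ^ 2

lemma continuous_smoothPosDeriv : Continuous smoothPosDeriv := by
  unfold smoothPosDeriv
  exact Continuous.div (by fun_prop) (by fun_prop) fun t => by positivity

lemma continuous_smoothPosDeriv₂ : Continuous smoothPosDeriv₂ := by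
  unfold smoothPosDeriv₂
  exact Continuous.div (by fun_prop) (by fun_prop) fun t => by positivity

lemma hasDerivAt_smoothPos (t : ℝ) : HasDerivAt smoothPos (smoothPosDeriv t) t := by
  have h_off : ∀ s ≠ (0 : ℝ), HasDerivAt smoothPos (smoothPosDeriv s) s := by
    intro s hs
    rcases lt_or_gt_of_ne hs with h | h
    · have : smoothPosDeriv s = 0 := by simp [smoothPosDeriv, max_eq_right h.le]
      rw [this]
      refine (hasDerivAt_const s (0 : ℝ)).congr_of_eventuallyEq ?_
      filter_upwards [Iio_mem_nhds h] with z hz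
      simp [smoothPos, max_eq_right (mem_Iio.1 hz).le]
    · have : smoothPosDeriv s = 1 - 1 / (1 + s ^ 2) := by
        have : 1 + s ^ 2 ≠ 0 := by positivity
        simp only [smoothPosDeriv, max_eq_left h.le]
        field_simp
        ring
      rw [this]
      refine ((hasDerivAt_id s).sub (Real.hasDerivAt_arctan s)).congr_of_eventuallyEq ?_
      filter_upwards [Ioi_mem_nhds h] with z hz
      simp [smoothPos, max_eq_left (mem_Ioi.1 hz).le]
  refine hasDerivAt_of_hasDerivAt_of_ne' h_off ?_ continuous_smoothPosDeriv.continuousAt t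
  unfold smoothPos
  exact (by fun_prop : Continuous fun t : ℝ => max t 0 - Real.arctan (max t 0)).continuousAt

lemma hasDerivAt_smoothPosDeriv (t : ℝ) :
    HasDerivAt smoothPosDeriv (smoothPosDeriv₂ t) t := by
  have h_off : ∀ s ≠ (0 : ℝ), HasDerivAt smoothPosDeriv (smoothPosDeriv₂ s) s := by
    intro s hs
    rcases lt_or_gt_of_ne hs with h | h
    · have : smoothPosDeriv₂ s = 0 := by simp [smoothPosDeriv₂, max_eq_right h.le]
      rw [this]
      refine (hasDerivAt_const s (0 : ℝ)).congr_of_eventuallyEq ?_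
      filter_upwards [Iio_mem_nhds h] with z hz
      simp [smoothPosDeriv, max_eq_right (mem_Iio.1 hz).le]
    · have h_sq : HasDerivAt (fun z : ℝ => z ^ 2) (2 * s) s := by simpa using hasDerivAt_pow 2 s
      have h_div := h_sq.div (h_sq.const_add 1) (by positivity)
      have : smoothPosDeriv₂ s = (2 * s * (1 + s ^ 2) - s ^ 2 * (2 * s)) / (1 + s ^ 2) ^ 2 := by
        simp only [smoothPosDeriv₂, max_eq_left h.le]
        ring
      rw [this]
      refine h_div.congr_of_eventuallyEq ?_
      filter_upwards [Ioi_mem_nhds h] with z hz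
      simp [smoothPosDeriv, max_eq_left (mem_Ioi.1 hz).le]
  exact hasDerivAt_of_hasDerivAt_of_ne' h_off continuous_smoothPosDeriv.continuousAt
    continuous_smoothPosDeriv₂.continuousAt t

lemma sub_two_le_smoothPos (t : ℝ) : t - 2 ≤ smoothPos t := by
  unfold smoothPos
  linarith [Real.arctan_lt_pi_div_two (max t 0), Real.pi_lt_four, le_max_left t 0]

lemma smoothPosDeriv_nonneg (t : ℝ) : 0 ≤ smoothPosDeriv t := by
  unfold smoothPosDeriv; positivity

lemma smoothPosDeriv_le_one (t : ℝ) : smoothPosDeriv t ≤ 1 := by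
  unfold smoothPosDeriv
  exact (div_le_one (by positivity)).2 (by linarith)

lemma smoothPosDeriv_of_nonpos {t : ℝ} (ht : t ≤ 0) : smoothPosDeriv t = 0 := by
  simp [smoothPosDeriv, max_eq_right ht]

lemma one_sub_le_smoothPosDeriv {t δ : ℝ} (hδ : 0 < δ) (ht : 1 / δ ≤ t) :
    1 - δ ≤ smoothPosDeriv t := by
  have ht0 : 0 < t := lt_of_lt_of_le (by positivity) ht
  have h1 : 1 ≤ t * δ := (div_le_iff₀ hδ).1 ht
  simp only [smoothPosDeriv, max_eq_left ht0.le]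
  rw [le_div_iff₀ (by positivity)]
  nlinarith [mul_nonneg hδ.le (sq_nonneg (t - 1))]

lemma smoothPos_nonneg (t : ℝ) : 0 ≤ smoothPos t := by
  have hmono : Monotone smoothPos := monotone_of_deriv_nonneg
    (fun t => (hasDerivAt_smoothPos t).differentiableAt)
    fun t => by rw [(hasDerivAt_smoothPos t).deriv]; exact smoothPosDeriv_nonneg t
  rcases le_total t 0 with h | h
  · simp [smoothPos, max_eq_right h]
  · simpa [smoothPos] using hmono h

lemma smoothPosDeriv₂_le_one (t : ℝ) : smoothPosDeriv₂ t ≤ 1 := by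
  unfold smoothPosDeriv₂
  rw [div_le_one (by positivity)]
  nlinarith [sq_nonneg (max t 0 - 1), sq_nonneg (max t 0 ^ 2)]

lemma Admissible.exists_bound_Ici {u : ℝ → ℝ} (hu : Admissible u) (s : ℝ) :
    ∃ M, 0 ≤ M ∧ ∀ y, s ≤ y → u y ≤ M := by
  obtain ⟨hc, h0, -, htop, -⟩ := hu
  obtain ⟨A, hA⟩ := eventually_atTop.1 (htop.eventually (eventually_le_nhds one_pos))
  obtain ⟨C, hC⟩ := (isCompact_Icc (a := s) (b := A)).bddAbove_image hc.continuousOn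
  refine ⟨max 1 C, by positivity, fun y hy => ?_⟩
  rcases le_total A y with h | h
  · exact (hA y h).trans (le_max_left _ _)
  · exact (hC ⟨y, ⟨hy, h⟩, rfl⟩).trans (le_max_right _ _)

/-- A coordinate potential `h`, with derivatives `h'` and `h''`, whose slope is at most `l` to the
right and at least `-c` to the left, and whose contribution to the drift is at most `η` everywhere
and at most `-(l * m) + η` outside `[-K, K]`, even after adding the push `max (-h') 0 * M` of the
preceding coordinate and the excess `c / 2 * u` passed on to the next one where `u` exceeds
`M'`. -/
structure IsCoordinatePotential (u : ℝ → ℝ) (m B l η c M M' K β : ℝ) (h h' h'' : ℝ → ℝ) :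
    Prop where
  hasDerivAt : ∀ y, HasDerivAt h (h' y) y
  hasDerivAt_deriv : ∀ y, HasDerivAt h' (h'' y) y
  continuous_deriv₂ : Continuous h''
  nonneg : ∀ y, 0 ≤ h y
  growth : ∀ y, c * |y| - β ≤ h y
  neg_le_deriv : ∀ y, -c ≤ h' y
  deriv_le : ∀ y, h' y ≤ l
  deriv₂_le : ∀ y, h'' y ≤ η
  drift_le : ∀ ν, m ≤ ν → ν ≤ B → ∀ y,
    h' y * (u y - ν) + max (-h' y) 0 * M + c / 2 * (if M' < u y then u y else 0) ≤ η ∧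
    (K ≤ |y| →
      h' y * (u y - ν) + max (-h' y) 0 * M + c / 2 * (if M' < u y then u y else 0)
        ≤ -(l * m) + η)

lemma Admissible.exists_coordinatePotential {u : ℝ → ℝ} (hu : Admissible u) {m B l η : ℝ}
    (hm : 0 < m) (hB : 0 < B) (hl : 0 < l) (hη : 0 < η) {c M : ℝ} (hc : 0 < c) (hcl : c ≤ l)
    (hM : 0 ≤ M) :
    ∃ M' K β, 0 ≤ M' ∧ ∃ h h' h'', IsCoordinatePotential u m B l η c M M' K β h h' h'' := by
  obtain ⟨-, h0, -, htop, hbot, -⟩ := id hu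
  have h_ev := htop.eventually (eventually_le_nhds (show 0 < η / (2 * l) by positivity))
  obtain ⟨a, ha0, ha⟩ : ∃ a, 0 ≤ a ∧ ∀ y, a ≤ y → u y ≤ η / (2 * l) := by
    obtain ⟨a, ha⟩ := eventually_atTop.1 h_ev
    exact ⟨max a 0, le_max_right _ _, fun y hy => ha y ((le_max_left _ _).trans hy)⟩
  have h_left : ∀ N, ∃ L, 0 ≤ L ∧ ∀ y, y ≤ -L → N ≤ u y := by
    intro N
    obtain ⟨L, hL⟩ := eventually_atBot.1 (hbot.eventually_ge_atTop N)
    exact ⟨max (-L) 0, le_max_right _ _, fun y hy => hL y (by linarith [le_max_left (-L) 0])⟩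
  obtain ⟨L, hL0, hL⟩ := h_left (3 * (B + M))
  obtain ⟨L₂, hL₂0, hL₂⟩ := h_left ((3 * c / 4 * (B + M) + l * m) * 4 / c)
  obtain ⟨κ, hκ⟩ : ∃ κ, κ = η / (2 * l) := ⟨_, rfl⟩
  have hκ0 : 0 < κ := by rw [hκ]; positivity
  have hκl : 2 * l * κ = η := by rw [hκ]; field_simp
  obtain ⟨M', hM'0, hM'⟩ := hu.exists_bound_Ici (-(L + 4 / κ))
  set δ := η / (2 * l * m) with hδ
  have hδ0 : 0 < δ := by positivity
  set h' : ℝ → ℝ := fun y => l * smoothPosDeriv (κ * (y - a)) - c * smoothPosDeriv (κ * (-L - y))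
    with hh'
  have hder_r : ∀ y, HasDerivAt (fun y => κ * (y - a)) κ y := fun y => by
    simpa using ((hasDerivAt_id y).sub_const a).const_mul κ
  have hder_l : ∀ y, HasDerivAt (fun y => κ * (-L - y)) (-κ) y := fun y => by
    simpa using ((hasDerivAt_id y).const_sub (-L)).const_mul κ
  have hright : ∀ y, a ≤ y → h' y = l * smoothPosDeriv (κ * (y - a)) := fun y hy => by
    simp only [hh']
    rw [smoothPosDeriv_of_nonpos (t := κ * (-L - y)) (by nlinarith)]; ring
  have hleft : ∀ y, y ≤ a → h' y = - (c * smoothPosDeriv (κ * (-L - y))) := fun y hy => by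
    simp only [hh']
    rw [smoothPosDeriv_of_nonpos (t := κ * (y - a)) (by nlinarith)]; ring
  have hsmall : ∀ y, -(L + 4 / κ) ≤ y → (if M' < u y then u y else 0) = 0 := fun y hy =>
    if_neg (hM' y hy).not_gt
  have h4κ : 0 < 4 / κ := by positivity
  refine ⟨M', max (a + 1 / δ / κ) (max L₂ (L + 4 / κ)), l * a + 2 * l / κ + c * L + 2 * c / κ,
    hM'0, fun y => l / κ * smoothPos (κ * (y - a)) + c / κ * smoothPos (κ * (-L - y)), h',
    fun y => l * κ * smoothPosDeriv₂ (κ * (y - a)) + c * κ * smoothPosDeriv₂ (κ * (-L - y)),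
    ?_, ?_, ?_, ?_, ?_, ?_, ?_, ?_, ?_⟩
  · intro y
    have h1 := ((hasDerivAt_smoothPos _).comp y (hder_r y)).const_mul (l / κ)
    have h2 := ((hasDerivAt_smoothPos _).comp y (hder_l y)).const_mul (c / κ)
    refine (h1.add h2).congr_deriv ?_
    simp only [hh']
    field_simp
    ring
  · intro y
    have h1 := ((hasDerivAt_smoothPosDeriv _).comp y (hder_r y)).const_mul l
    have h2 := ((hasDerivAt_smoothPosDeriv _).comp y (hder_l y)).const_mul c
    refine (h1.sub h2).congr_deriv ?_
    ring
  · have := continuous_smoothPosDeriv₂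
    fun_prop
  · intro y
    have h1 := smoothPos_nonneg (κ * (y - a))
    have h2 := smoothPos_nonneg (κ * (-L - y))
    positivity
  · intro y
    have h1 := smoothPos_nonneg (κ * (y - a))
    have h2 := smoothPos_nonneg (κ * (-L - y))
    have h3 : l / κ * (κ * (y - a) - 2) ≤ l / κ * smoothPos (κ * (y - a)) :=
      mul_le_mul_of_nonneg_left (sub_two_le_smoothPos _) (by positivity)
    have h4 : c / κ * (κ * (-L - y) - 2) ≤ c / κ * smoothPos (κ * (-L - y)) :=
      mul_le_mul_of_nonneg_left (sub_two_le_smoothPos _) (by positivity)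
    have h5 : l / κ * (κ * (y - a) - 2) = l * y - l * a - 2 * l / κ := by field_simp
    have h6 : c / κ * (κ * (-L - y) - 2) = -(c * L) - c * y - 2 * c / κ := by field_simp
    have h7 : 0 ≤ l / κ * smoothPos (κ * (y - a)) := by positivity
    have h8 : 0 ≤ c / κ * smoothPos (κ * (-L - y)) := by positivity
    have h9 : 0 ≤ 2 * l / κ := by positivity
    have h10 : 0 ≤ 2 * c / κ := by positivity
    have h11 : 0 ≤ l * a := by positivity
    have h12 : 0 ≤ c * L := by positivity
    rcases le_total 0 y with hy | hy
    · rw [abs_of_nonneg hy]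
      nlinarith
    · rw [abs_of_nonpos hy]
      nlinarith
  · intro y
    simp only [hh']
    nlinarith [smoothPosDeriv_nonneg (κ * (y - a)), smoothPosDeriv_le_one (κ * (-L - y))]
  · intro y
    simp only [hh']
    nlinarith [smoothPosDeriv_nonneg (κ * (-L - y)), smoothPosDeriv_le_one (κ * (y - a))]
  · intro y
    have h1 : l * κ * smoothPosDeriv₂ (κ * (y - a)) ≤ l * κ * 1 :=
      mul_le_mul_of_nonneg_left (smoothPosDeriv₂_le_one _) (by positivity)
    have h2 : c * κ * smoothPosDeriv₂ (κ * (-L - y)) ≤ c * κ * 1 :=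
      mul_le_mul_of_nonneg_left (smoothPosDeriv₂_le_one _) (by positivity)
    nlinarith
  · intro ν hmν hνB y
    have hr1 : a ≤ y → 0 ≤ h' y ∧ h' y * u y ≤ η / 2 := by
      intro hy
      have h1 := smoothPosDeriv_nonneg (κ * (y - a))
      have h2 := smoothPosDeriv_le_one (κ * (y - a))
      have h3 : 0 ≤ h' y := by rw [hright y hy]; positivity
      refine ⟨h3, ?_⟩
      calc h' y * u y ≤ l * (η / (2 * l)) :=
            mul_le_mul (by rw [hright y hy]; nlinarith) (ha y hy) (h0 y) hl.le
        _ = η / 2 := by field_simp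
    have hl1 : ∀ s, 0 ≤ s → y ≤ a → s = c * smoothPosDeriv (κ * (-L - y)) →
        h' y * (u y - ν) + max (-h' y) 0 * M = s * (ν + M - u y) := by
      intro s hs hy hs'
      rw [hleft y hy, ← hs', neg_neg, max_eq_left hs]
      ring
    have hl2 : y ≤ -(L + 4 / κ) →
        h' y * (u y - ν) + max (-h' y) 0 * M + c / 2 * (if M' < u y then u y else 0)
          ≤ 3 * c / 4 * (B + M) - c / 4 * u y := by
      intro hy
      have h34 : 1 - 1 / 4 ≤ smoothPosDeriv (κ * (-L - y)) := by
        refine one_sub_le_smoothPosDeriv (by norm_num) ?_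
        have : κ * (4 / κ) ≤ κ * (-L - y) := mul_le_mul_of_nonneg_left (by linarith) hκ0.le
        rw [mul_div_cancel₀ _ hκ0.ne'] at this
        linarith
      rw [hl1 _ (mul_nonneg hc.le (smoothPosDeriv_nonneg _)) (by linarith) rfl]
      have h1 : (if M' < u y then u y else 0) ≤ u y := by split_ifs <;> simp [h0 y]
      have h2 := hL y (by linarith)
      have h3 : (3 * c / 4) * (u y - ν - M) ≤
          c * smoothPosDeriv (κ * (-L - y)) * (u y - ν - M) :=
        mul_le_mul_of_nonneg_right (by nlinarith) (by linarith)
      have h4 : c / 2 * (if M' < u y then u y else 0) ≤ c / 2 * u y :=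
        mul_le_mul_of_nonneg_left h1 (by positivity)
      nlinarith
    refine ⟨?_, fun hK => ?_⟩
    · rcases le_total a y with hy | hy
      · obtain ⟨h1, h2⟩ := hr1 hy
        rw [hsmall y (by linarith), max_eq_right (by linarith)]
        nlinarith
      · rcases le_total y (-(L + 4 / κ)) with hy' | hy'
        · have := hl2 hy'
          have := hL y (by linarith)
          nlinarith
        · rw [hsmall y hy', hl1 _ (mul_nonneg hc.le (smoothPosDeriv_nonneg _)) hy rfl]
          rcases le_total y (-L) with hyL | hyL
          · have h1 := hL y hyL
            have h2 := mul_nonneg hc.le (smoothPosDeriv_nonneg (κ * (-L - y)))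
            nlinarith
          · rw [smoothPosDeriv_of_nonpos (by nlinarith)]
            linarith
    · have hK1 := (le_max_left _ _).trans hK
      have hK2 := ((le_max_left _ _).trans (le_max_right _ _)).trans hK
      have hK3 := ((le_max_right _ _).trans (le_max_right _ _)).trans hK
      have hδκ : 0 < 1 / δ / κ := by positivity
      rcases le_total 0 y with hy | hy
      · rw [abs_of_nonneg hy] at hK1
        have hya : a ≤ y := by linarith
        obtain ⟨h1, h2⟩ := hr1 hya
        rw [hsmall y (by linarith), max_eq_right (by linarith)]
        have h3 : 1 - δ ≤ smoothPosDeriv (κ * (y - a)) := by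
          refine one_sub_le_smoothPosDeriv hδ0 ?_
          have : κ * (1 / δ / κ) ≤ κ * (y - a) := mul_le_mul_of_nonneg_left (by linarith) hκ0.le
          rwa [mul_div_cancel₀ _ hκ0.ne'] at this
        have h4 : l * m * δ = η / 2 := by rw [hδ]; field_simp
        have h5 : l * (1 - δ) ≤ h' y := by
          rw [hright y hya]
          exact mul_le_mul_of_nonneg_left h3 hl.le
        nlinarith [mul_le_mul_of_nonneg_left hmν h1, mul_le_mul_of_nonneg_right h5 hm.le]
      · rw [abs_of_nonpos hy] at hK2 hK3
        have h1 := hl2 (by linarith)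
        have h2 := hL₂ y (by linarith)
        rw [div_le_iff₀ hc] at h2
        linarith

lemma Admissible.exists_coordinatePotential_seq {u : ℝ → ℝ} (hu : Admissible u) {m B l η : ℝ}
    (hm : 0 < m) (hB : 0 < B) (hl : 0 < l) (hη : 0 < η) :
    ∃ (M K β : ℕ → ℝ) (h h' h'' : ℕ → ℝ → ℝ), (∀ n, 0 ≤ M n) ∧ ∀ n,
      IsCoordinatePotential u m B l η (l / 2 ^ n) (M n) (M (n + 1)) (K n) (β n)
        (h n) (h' n) (h'' n) := by
  have hex : ∀ (n : ℕ) (M : {M : ℝ // 0 ≤ M}), ∃ (M' : {M : ℝ // 0 ≤ M}) (K β : ℝ)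
      (h h' h'' : ℝ → ℝ), IsCoordinatePotential u m B l η (l / 2 ^ n) M M' K β h h' h'' := by
    intro n M
    obtain ⟨M', K, β, hM', h, h', h'', H⟩ := hu.exists_coordinatePotential hm hB hl hη
      (c := l / 2 ^ n) (by positivity) (div_le_self hl.le (one_le_pow₀ one_le_two)) M.2
    exact ⟨⟨M', hM'⟩, K, β, h, h', h'', H⟩
  choose M' K β h h' h'' H using hex
  let M : ℕ → {M : ℝ // 0 ≤ M} := fun n => Nat.rec ⟨0, le_rfl⟩ (fun n M => M' n M) n
  exact ⟨fun n => (M n).1, fun n => K n (M n), fun n => β n (M n), fun n => h n (M n),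
    fun n => h' n (M n), fun n => h'' n (M n), fun n => (M n).2, fun n => H n (M n)⟩

section Separable

variable {d : ℕ} {h h' h'' : Fin d → ℝ → ℝ}

lemma contDiff_two_of_hasDerivAt {f f' f'' : ℝ → ℝ} (h1 : ∀ y, HasDerivAt f (f' y) y)
    (h2 : ∀ y, HasDerivAt f' (f'' y) y) (h3 : Continuous f'') : ContDiff ℝ 2 f := by
  have e1 : deriv f = f' := funext fun y => (h1 y).deriv
  have e2 : deriv f' = f'' := funext fun y => (h2 y).deriv
  have : ContDiff ℝ 1 f' :=
    contDiff_one_iff_deriv.2 ⟨fun y => (h2 y).differentiableAt, e2 ▸ h3⟩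
  exact (contDiff_succ_iff_deriv (n := 1)).2
    ⟨fun y => (h1 y).differentiableAt, by simp, e1 ▸ this⟩

lemma hasFDerivAt_exp_sum (hh : ∀ i y, HasDerivAt (h i) (h' i y) y)
    (x : EuclideanSpace ℝ (Fin d)) :
    HasFDerivAt (fun x : EuclideanSpace ℝ (Fin d) => Real.exp (∑ i, h i (x i)))
      (Real.exp (∑ i, h i (x i)) •
        ∑ i, h' i (x i) • (EuclideanSpace.proj i : EuclideanSpace ℝ (Fin d) →L[ℝ] ℝ)) x := by
  refine HasFDerivAt.exp (HasFDerivAt.fun_sum fun i _ => ?_)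
  exact (hh i (x i)).comp_hasFDerivAt x
    (EuclideanSpace.proj i : EuclideanSpace ℝ (Fin d) →L[ℝ] ℝ).hasFDerivAt

lemma fderiv_exp_sum_single (hh : ∀ i y, HasDerivAt (h i) (h' i y) y)
    (x : EuclideanSpace ℝ (Fin d)) (j : Fin d) :
    fderiv ℝ (fun x : EuclideanSpace ℝ (Fin d) => Real.exp (∑ i, h i (x i))) x
      (EuclideanSpace.single j (1 : ℝ)) = Real.exp (∑ i, h i (x i)) * h' j (x j) := by
  rw [(hasFDerivAt_exp_sum hh x).fderiv]
  simp

lemma fderiv_fderiv_exp_sum_single (hh : ∀ i y, HasDerivAt (h i) (h' i y) y)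
    (hh' : ∀ i y, HasDerivAt (h' i) (h'' i y) y) (x : EuclideanSpace ℝ (Fin d)) (i j : Fin d) :
    fderiv ℝ (fun y => fderiv ℝ (fun x : EuclideanSpace ℝ (Fin d) =>
      Real.exp (∑ i, h i (x i))) y (EuclideanSpace.single j (1 : ℝ))) x
      (EuclideanSpace.single i (1 : ℝ)) =
      Real.exp (∑ i, h i (x i)) * (h' i (x i) * h' j (x j) + if i = j then h'' j (x j) else 0) := by
  simp_rw [fderiv_exp_sum_single hh]
  have hj : HasFDerivAt (fun y : EuclideanSpace ℝ (Fin d) => h' j (y j))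
      (h'' j (x j) • (EuclideanSpace.proj j : EuclideanSpace ℝ (Fin d) →L[ℝ] ℝ)) x :=
    (hh' j (x j)).comp_hasFDerivAt x
      (EuclideanSpace.proj j : EuclideanSpace ℝ (Fin d) →L[ℝ] ℝ).hasFDerivAt
  rw [((hasFDerivAt_exp_sum hh x).fun_mul hj).fderiv]
  simp [eq_comm (a := i)]
  split_ifs <;> ring

lemma generator_exp_sum (hh : ∀ i y, HasDerivAt (h i) (h' i y) y)
    (hh' : ∀ i y, HasDerivAt (h' i) (h'' i y) y) (Γ : Matrix (Fin d) (Fin d) ℝ) (μ : Fin d → ℝ)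
    (u : ℝ → ℝ) (x : EuclideanSpace ℝ (Fin d)) :
    generator Γ μ u (fun x => Real.exp (∑ i, h i (x i))) x =
      Real.exp (∑ i, h i (x i)) * (1 / 2 * ∑ i, ∑ j, Γ i j * (h' i (x i) * h' j (x j)) +
        1 / 2 * ∑ i, Γ i i * h'' i (x i) + ∑ i, driftCoeff μ u x i * h' i (x i)) := by
  unfold generator
  simp_rw [fderiv_fderiv_exp_sum_single hh hh', fderiv_exp_sum_single hh]
  have h1 : ∀ i j, Γ i j * (Real.exp (∑ i, h i (x i)) *
      (h' i (x i) * h' j (x j) + if i = j then h'' j (x j) else 0)) =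
      Real.exp (∑ i, h i (x i)) * (Γ i j * (h' i (x i) * h' j (x j))) +
        if i = j then Real.exp (∑ i, h i (x i)) * (Γ i i * h'' i (x i)) else 0 := by
    intro i j
    split_ifs with hij
    · subst hij; ring
    · ring
  have h2 : ∀ i, driftCoeff μ u x i * (Real.exp (∑ i, h i (x i)) * h' i (x i)) =
      Real.exp (∑ i, h i (x i)) * (driftCoeff μ u x i * h' i (x i)) := fun i => by ring
  simp_rw [h1, h2, Finset.sum_add_distrib, ← Finset.mul_sum]
  simp only [Finset.sum_ite_eq, Finset.mem_univ, if_true, ← Finset.mul_sum]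
  ring

end Separable

lemma EuclideanSpace.norm_le_sum_abs {ι : Type*} [Fintype ι] (x : EuclideanSpace ℝ ι) :
    ‖x‖ ≤ ∑ i, |x i| := by
  rw [EuclideanSpace.norm_eq]
  refine Real.sqrt_le_iff.2 ⟨by positivity, ?_⟩
  exact Finset.sum_sq_le_sq_sum_of_nonneg fun i _ => abs_nonneg _

lemma sum_mul_mul_le_norm {ι : Type*} [Fintype ι] [DecidableEq ι] (A : Matrix ι ι ℝ)
    (p : ι → ℝ) :
    ∑ i, ∑ j, A i j * (p i * p j) ≤ ‖Matrix.toEuclideanCLM (𝕜 := ℝ) A‖ * ∑ i, p i ^ 2 := by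
  have h1 : ∑ i, ∑ j, A i j * (p i * p j) =
      inner ℝ (WithLp.toLp 2 p) (Matrix.toEuclideanCLM (𝕜 := ℝ) A (WithLp.toLp 2 p)) := by
    rw [Matrix.inner_toEuclideanCLM]
    simp only [dotProduct, Matrix.mulVec, Finset.mul_sum]
    exact Finset.sum_congr rfl fun i _ => Finset.sum_congr rfl fun j _ => by ring
  have h2 : ∑ i, p i ^ 2 = ‖WithLp.toLp 2 p‖ ^ 2 := by
    rw [EuclideanSpace.real_norm_sq_eq]
  rw [h1, h2]
  calc _ ≤ ‖WithLp.toLp 2 p‖ * ‖Matrix.toEuclideanCLM (𝕜 := ℝ) A (WithLp.toLp 2 p)‖ :=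
        real_inner_le_norm _ _
    _ ≤ ‖WithLp.toLp 2 p‖ * (‖Matrix.toEuclideanCLM (𝕜 := ℝ) A‖ * ‖WithLp.toLp 2 p‖) := by
        gcongr
        exact ContinuousLinearMap.le_opNorm _ _
    _ = _ := by ring

lemma apply_self_le_norm {ι : Type*} [Fintype ι] [DecidableEq ι] (A : Matrix ι ι ℝ) (i : ι) :
    A i i ≤ ‖Matrix.toEuclideanCLM (𝕜 := ℝ) A‖ := by
  simpa [Pi.single_apply] using sum_mul_mul_le_norm A (Pi.single i 1)

lemma Fin.sum_pred_le_sum {d : ℕ} {e : Fin d → ℝ} (he : ∀ i, 0 ≤ e i) :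
    ∑ i : Fin d, (if (i : ℕ) = 0 then 0 else
      e ⟨(i : ℕ) - 1, lt_of_le_of_lt (Nat.sub_le _ _) i.isLt⟩) ≤ ∑ i, e i := by
  cases d with
  | zero => simp
  | succ n =>
    rw [Fin.sum_univ_succ, Fin.sum_univ_castSucc (f := e)]
    simpa [Fin.castSucc, Fin.castAdd, Fin.castLE] using he (Fin.last n)

lemma sum_driftCoeff_mul_le {d : ℕ} {u : ℝ → ℝ} (hu : ∀ y, 0 ≤ u y) {m B l η : ℝ} (hl : 0 < l)
    {M K β : ℕ → ℝ} {h h' h'' : ℕ → ℝ → ℝ} (hM : ∀ n, 0 ≤ M n)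
    (H : ∀ n, IsCoordinatePotential u m B l η (l / 2 ^ n) (M n) (M (n + 1)) (K n) (β n)
      (h n) (h' n) (h'' n))
    {μ : Fin d → ℝ} (hm : ∀ i, m ≤ -μ i) (hB : ∀ i, -μ i ≤ B) (x : EuclideanSpace ℝ (Fin d)) :
    ∑ i, driftCoeff μ u x i * h' i (x i) ≤ d * η ∧
      ((∃ i : Fin d, K i ≤ |x i|) →
        ∑ i, driftCoeff μ u x i * h' i (x i) ≤ -(l * m) + d * η) := by
  set e : Fin d → ℝ := fun i =>
    l / 2 ^ (i : ℕ) / 2 * (if M (i + 1) < u (x i) then u (x i) else 0) with he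
  set S : Fin d → ℝ := fun i => h' i (x i) * (u (x i) - -μ i) + max (-h' i (x i)) 0 * M i + e i
    with hS
  have he0 : ∀ i, 0 ≤ e i := fun i => by
    simp only [he]
    have := hu (x i)
    split_ifs <;> positivity
  have hterm : ∀ i : Fin d, driftCoeff μ u x i * h' i (x i) ≤ S i - e i +
      (if (i : ℕ) = 0 then 0 else
        e ⟨(i : ℕ) - 1, lt_of_le_of_lt (Nat.sub_le _ _) i.isLt⟩) := by
    rintro ⟨i, hi⟩
    have hMi := hM i
    cases i with
    | zero =>
      have : 0 ≤ max (-h' 0 (x ⟨0, hi⟩)) 0 * M 0 := mul_nonneg (le_max_right _ _) hMi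
      simp only [driftCoeff, hS, if_true]
      linarith
    | succ k =>
      have hw := hu (x ⟨k, by omega⟩)
      have hneg := (H (k + 1)).neg_le_deriv (x ⟨k + 1, hi⟩)
      have hpush : -h' (k + 1) (x ⟨k + 1, hi⟩) * u (x ⟨k, by omega⟩) ≤
          max (-h' (k + 1) (x ⟨k + 1, hi⟩)) 0 * M (k + 1) + e ⟨k, by omega⟩ := by
        have h1 := le_max_left (-h' (k + 1) (x ⟨k + 1, hi⟩)) 0
        have h2 := le_max_right (-h' (k + 1) (x ⟨k + 1, hi⟩)) 0
        simp only [he]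
        split_ifs with hlt
        · have : l / 2 ^ k / 2 = l / 2 ^ (k + 1) := by rw [pow_succ]; field_simp
          rw [this]
          nlinarith [mul_nonneg h2 hMi]
        · nlinarith
      simp only [driftCoeff, hS, Nat.add_sub_cancel, Nat.add_eq_zero_iff, one_ne_zero, and_false,
        if_false]
      linarith
  have hsum : ∑ i, driftCoeff μ u x i * h' i (x i) ≤ ∑ i, S i := by
    calc _ ≤ ∑ i, (S i - e i + _) := Finset.sum_le_sum fun i _ => hterm i
      _ = ∑ i, S i - ∑ i, e i + _ := by rw [Finset.sum_add_distrib, Finset.sum_sub_distrib]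
      _ ≤ ∑ i, S i := by linarith [Fin.sum_pred_le_sum he0]
  refine ⟨hsum.trans ?_, fun ⟨i₀, hi₀⟩ => hsum.trans ?_⟩
  · calc ∑ i, S i ≤ ∑ _i : Fin d, η :=
          Finset.sum_le_sum fun i _ => ((H i).drift_le _ (hm i) (hB i) (x i)).1
      _ = d * η := by simp
  · calc ∑ i, S i ≤ ∑ i : Fin d, ((if i = i₀ then -(l * m) else 0) + η) := by
          refine Finset.sum_le_sum fun i _ => ?_
          have := (H i).drift_le _ (hm i) (hB i) (x i)
          split_ifs with hi
          · subst hi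
            exact this.2 hi₀
          · rw [zero_add]
            exact this.1
      _ = -(l * m) + d * η := by simp [Finset.sum_add_distrib]

lemma normLike_exp_sum {d : ℕ} {h h' h'' : Fin d → ℝ → ℝ} {c β : ℝ} (hc : 0 < c)
    (hh : ∀ i y, HasDerivAt (h i) (h' i y) y) (hh' : ∀ i y, HasDerivAt (h' i) (h'' i y) y)
    (hh'' : ∀ i, Continuous (h'' i)) (h0 : ∀ i y, 0 ≤ h i y)
    (hgrowth : ∀ x : EuclideanSpace ℝ (Fin d), c * ‖x‖ - β ≤ ∑ i, h i (x i)) :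
    NormLike fun x : EuclideanSpace ℝ (Fin d) => Real.exp (∑ i, h i (x i)) := by
  refine ⟨fun x => Real.one_le_exp (Finset.sum_nonneg fun i _ => h0 i _), ?_, ?_⟩
  · refine ContDiff.exp (ContDiff.sum fun i _ => ?_)
    exact (contDiff_two_of_hasDerivAt (hh i) (hh' i) (hh'' i)).comp
      (EuclideanSpace.proj i : EuclideanSpace ℝ (Fin d) →L[ℝ] ℝ).contDiff
  · refine Real.tendsto_exp_atTop.comp (tendsto_atTop_mono hgrowth ?_)
    exact tendsto_atTop_add_const_right _ _ (tendsto_comap.const_mul_atTop hc)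

/-- Exponential drift condition for the GRBM. -/
theorem exponential_drift_condition
    (d : ℕ) (hd : 1 ≤ d) (Γ : Matrix (Fin d) (Fin d) ℝ) (hΓsym : Γ.IsSymm) (hΓpd : Γ.PosDef)
    (μ : Fin d → ℝ) (hμ : ∀ i, μ i < 0) (u : ℝ → ℝ) (hu : Admissible u) :
    ∀ ε > 0, ∃ b r : ℝ, 0 < r ∧ ∃ V : EuclideanSpace ℝ (Fin d) → ℝ, NormLike V ∧
      ∀ x, generator Γ μ u V x ≤
        -(1 / (2 * d * ‖Matrix.toEuclideanCLM (𝕜 := ℝ) Γ‖)) * ((⨅ i, (μ i)^2) - ε) * V x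
          + Set.indicator (Metric.closedBall 0 r) (fun _ => b) x := by
  intro ε hε
  have : Nonempty (Fin d) := ⟨⟨0, hd⟩⟩
  obtain ⟨i₀, hi₀⟩ := exists_eq_ciInf_of_finite (f := fun i => (μ i) ^ 2)
  set m := -μ i₀ with hm_def
  have hm0 : 0 < m := by linarith [hμ i₀]
  have hm : ∀ i, m ≤ -μ i := fun i => by
    have h1 : (μ i₀) ^ 2 ≤ (μ i) ^ 2 := hi₀ ▸ ciInf_le (Finite.bddBelow_range _) i
    exact abs_le_of_sq_le_sq' (by nlinarith) (by linarith [hμ i]) |>.2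
  have hmin : ⨅ i, (μ i) ^ 2 = m ^ 2 := by rw [← hi₀, hm_def, neg_sq]
  obtain ⟨B, hB⟩ : ∃ B, ∀ i, -μ i ≤ B :=
    ⟨∑ i, -μ i, fun i => Finset.single_le_sum (f := fun i => -μ i)
      (fun j _ => by linarith [hμ j]) (Finset.mem_univ i)⟩
  have hB0 : 0 < B := by linarith [hB i₀, hμ i₀]
  set G := ‖Matrix.toEuclideanCLM (𝕜 := ℝ) Γ‖ with hG
  have hG0 : 0 < G := hΓpd.diag_pos.trans_le (apply_self_le_norm Γ i₀)
  have hd0 : (0 : ℝ) < d := by exact_mod_cast hd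
  set l := m / (d * G) with hl_def
  have hl : 0 < l := by positivity
  set η := ε / (2 * d * G) / (1 / 2 * d * G + d) with hη_def
  have hη : 0 < η := by positivity
  obtain ⟨M, K, β, h, h', h'', hM, H⟩ := hu.exists_coordinatePotential_seq hm0 hB0 hl hη
  set V : EuclideanSpace ℝ (Fin d) → ℝ := fun x => Real.exp (∑ i : Fin d, h i (x i)) with hV
  have hgrowth : ∀ x : EuclideanSpace ℝ (Fin d),
      l / 2 ^ d * ‖x‖ - ∑ i : Fin d, β i ≤ ∑ i : Fin d, h i (x i) := by
    intro x
    calc l / 2 ^ d * ‖x‖ - ∑ i : Fin d, β i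
        ≤ l / 2 ^ d * ∑ i, |x i| - ∑ i : Fin d, β i := by
          gcongr
          exact EuclideanSpace.norm_le_sum_abs x
      _ = ∑ i : Fin d, (l / 2 ^ d * |x i| - β i) := by
          rw [Finset.mul_sum, Finset.sum_sub_distrib]
      _ ≤ ∑ i : Fin d, h i (x i) := by
          refine Finset.sum_le_sum fun i _ => le_trans ?_ ((H i).growth (x i))
          gcongr
          · exact one_le_two
          · exact i.isLt.le
  have hnorm : NormLike V := normLike_exp_sum (by positivity) (fun i => (H i).hasDerivAt)
    (fun i => (H i).hasDerivAt_deriv) (fun i => (H i).continuous_deriv₂)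
    (fun i => (H i).nonneg) hgrowth
  have hV0 : ∀ x, 0 < V x := fun x => Real.exp_pos _
  have hquad : ∀ x : EuclideanSpace ℝ (Fin d),
      1 / 2 * ∑ i, ∑ j, Γ i j * (h' i (x i) * h' j (x j)) ≤ 1 / 2 * (G * (d * l ^ 2)) := by
    intro x
    refine mul_le_mul_of_nonneg_left ((sum_mul_mul_le_norm Γ _).trans ?_) (by norm_num)
    refine mul_le_mul_of_nonneg_left ?_ hG0.le
    calc ∑ i : Fin d, h' i (x i) ^ 2 ≤ ∑ _i : Fin d, l ^ 2 := by
          refine Finset.sum_le_sum fun i _ => sq_le_sq' ?_ ((H i).deriv_le _)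
          have := (H i).neg_le_deriv (x i)
          have := div_le_self hl.le (one_le_pow₀ one_le_two : (1 : ℝ) ≤ 2 ^ (i : ℕ))
          linarith
      _ = d * l ^ 2 := by simp
  have htrace : ∀ x : EuclideanSpace ℝ (Fin d),
      1 / 2 * ∑ i : Fin d, Γ i i * h'' i (x i) ≤ 1 / 2 * (d * (G * η)) := by
    intro x
    refine mul_le_mul_of_nonneg_left ?_ (by norm_num)
    calc ∑ i : Fin d, Γ i i * h'' i (x i) ≤ ∑ _i : Fin d, G * η := by
          refine Finset.sum_le_sum fun i _ => ?_
          exact (mul_le_mul_of_nonneg_left ((H i).deriv₂_le _) hΓpd.diag_pos.le).trans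
            (mul_le_mul_of_nonneg_right (apply_self_le_norm Γ i) hη.le)
      _ = d * (G * η) := by simp
  set ρ := 1 / (2 * d * G) * (m ^ 2 - ε) with hρ
  have hgen : ∀ x, generator Γ μ u V x ≤ (-ρ + l * m) * V x ∧
      ((∃ i : Fin d, K i ≤ |x i|) → generator Γ μ u V x ≤ -ρ * V x) := by
    intro x
    obtain ⟨h1, h2⟩ := sum_driftCoeff_mul_le hu.2.1 hl hM H hm hB x
    have hrate : 1 / 2 * (G * (d * l ^ 2)) + 1 / 2 * (d * (G * η)) + (-(l * m) + d * η) = -ρ := by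
      have h3 : 1 / 2 * (d * (G * η)) + d * η = ε / (2 * d * G) := by
        rw [hη_def]; field_simp
      have h4 : 1 / 2 * (G * (d * l ^ 2)) - l * m = -(m ^ 2 / (2 * d * G)) := by
        rw [hl_def]; field_simp; ring
      have h5 : ρ = m ^ 2 / (2 * d * G) - ε / (2 * d * G) := by rw [hρ]; ring
      linarith
    rw [hV, generator_exp_sum (fun i => (H i).hasDerivAt) (fun i => (H i).hasDerivAt_deriv)]
    refine ⟨?_, fun hx => ?_⟩
    · rw [mul_comm]
      exact mul_le_mul_of_nonneg_right (by linarith [hquad x, htrace x]) (hV0 x).le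
    · rw [mul_comm]
      exact mul_le_mul_of_nonneg_right (by linarith [hquad x, htrace x, h2 hx]) (hV0 x).le
  set r := ∑ i : Fin d, |K i| + 1 with hr
  have hr0 : 0 < r := by positivity
  obtain ⟨C, hC⟩ := (isCompact_closedBall (0 : EuclideanSpace ℝ (Fin d)) r).bddAbove_image
    hnorm.2.1.continuous.continuousOn
  refine ⟨l * m * C, r, hr0, V, hnorm, fun x => ?_⟩
  rw [hmin, neg_mul, ← hρ]
  by_cases hx : x ∈ Metric.closedBall 0 r
  · rw [Set.indicator_of_mem hx]
    have h1 := (hgen x).1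
    have h2 := mul_le_mul_of_nonneg_left (hC ⟨x, hx, rfl⟩) (mul_pos hl hm0).le
    linarith
  · rw [Set.indicator_of_notMem hx, add_zero]
    refine (hgen x).2 ?_
    by_contra! hcon
    refine hx (mem_closedBall_zero_iff.2 ?_)
    calc ‖x‖ ≤ ∑ i, |x i| := EuclideanSpace.norm_le_sum_abs x
      _ ≤ ∑ i : Fin d, |K i| := Finset.sum_le_sum fun i _ => (hcon i).le.trans (le_abs_self _)
      _ ≤ r := by linarith
end
end

section
/- Let μ₁, μ₂ < 0 and let u be an admissible potential derivative. For every ε > 0 there exists R > 0 such that for every x = (x₁, x₂) ∈ ℝ² with ‖x‖ ≥ R, β₂(x) ≤ −min(|μ₁|, |μ₂|) + ε. -/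
open Filter Real Set

noncomputable section

/-- The two-dimensional drift functional
`β₂(x) = (1/‖x‖)·[(μ₁ + u(x₁))x₁ + (μ₂ + u(x₂) − u(x₁))x₂]`. -/
def beta2 (μ₁ μ₂ : ℝ) (u : ℝ → ℝ) (x : EuclideanSpace ℝ (Fin 2)) : ℝ :=
  (1 / ‖x‖) * ((μ₁ + u (x 0)) * x 0 + (μ₂ + u (x 1) - u (x 0)) * x 1)

namespace Admissible

variable {u : ℝ → ℝ}

theorem exists_bound_on_nonneg (hu : Admissible u) : ∃ M, 0 ≤ M ∧ ∀ t, 0 ≤ t → u t ≤ M := by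
  obtain ⟨hc, -, -, htop, -, -⟩ := hu
  obtain ⟨K, hK⟩ := eventually_atTop.1 (htop.eventually (ge_mem_nhds (zero_lt_one' ℝ)))
  obtain ⟨M, hM⟩ := (isCompact_Icc (a := 0) (b := K)).bddAbove_image hc.continuousOn
  refine ⟨max M 1, by positivity, fun t ht => ?_⟩
  rcases le_total t K with h | h
  · exact (hM (mem_image_of_mem u ⟨ht, h⟩)).trans (le_max_left _ _)
  · exact (hK t h).trans (le_max_right _ _)

theorem mul_self_le_on_nonneg (hu : Admissible u) {δ : ℝ} (hδ : 0 < δ) :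
    ∃ C, 0 ≤ C ∧ ∀ t, 0 ≤ t → u t * t ≤ δ * t + C := by
  obtain ⟨M, hM0, hM⟩ := hu.exists_bound_on_nonneg
  obtain ⟨-, -, -, htop, -, -⟩ := hu
  obtain ⟨K, hK⟩ := eventually_atTop.1 (htop.eventually (ge_mem_nhds hδ))
  refine ⟨M * max K 0, by positivity, fun t ht => ?_⟩
  have hC : 0 ≤ M * max K 0 := by positivity
  rcases le_total t K with h | h
  · have h1 : u t * t ≤ M * max K 0 :=
      mul_le_mul (hM t ht) (h.trans (le_max_left _ _)) ht hM0
    nlinarith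
  · nlinarith [hK t h]

theorem exists_le_on_neg (hu : Admissible u) (N : ℝ) :
    ∃ K, 0 ≤ K ∧ ∀ t, K ≤ t → N ≤ u (-t) := by
  obtain ⟨-, -, -, -, hbot, -⟩ := hu
  obtain ⟨K, hK⟩ := eventually_atBot.1 (hbot.eventually_ge_atTop N)
  exact ⟨max (-K) 0, le_max_right _ _, fun t ht => hK _ (by linarith [le_max_left (-K) 0])⟩

theorem linear_le_mul_self_on_neg (hu : Admissible u) {N : ℝ} (hN : 0 ≤ N) :
    ∃ C, 0 ≤ C ∧ ∀ t, 0 ≤ t → N * t ≤ u (-t) * t + C := by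
  obtain ⟨K, hK0, hK⟩ := hu.exists_le_on_neg N
  refine ⟨N * K, by positivity, fun t ht => ?_⟩
  have hC : 0 ≤ N * K := by positivity
  rcases le_total t K with h | h
  · nlinarith [mul_nonneg (hu.2.1 (-t)) ht]
  · nlinarith [hK t h]

theorem exists_two_mul_half_le (hu : Admissible u) :
    ∃ K, 0 ≤ K ∧ ∀ s, K ≤ s → 2 * u (-(s / 2)) ≤ u (-s) := by
  obtain ⟨K₁, hK₁0, hK₁⟩ := hu.exists_le_on_neg 1
  have hratio := hu.2.2.2.2.2 1 (1 / 2) (by norm_num) (by norm_num)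
  obtain ⟨K₂, hK₂⟩ := eventually_atBot.1 (hratio.eventually_ge_atTop 2)
  refine ⟨max (2 * K₁) (-K₂), by positivity, fun s hs => ?_⟩
  have h1 := hK₁ (s / 2) (by linarith [le_max_left (2 * K₁) (-K₂)])
  have h2 := hK₂ (-s) (by linarith [le_max_right (2 * K₁) (-K₂)])
  rw [show (1 : ℝ) * -s = -s by ring, show (1 / 2 : ℝ) * -s = -(s / 2) by ring,
    le_div_iff₀ (by linarith)] at h2
  exact h2

/-- The interaction terms dominate every linear function on the negative quadrant. -/
theorem linear_le_on_neg_quadrant (hu : Admissible u) {N : ℝ} (hN : 0 ≤ N) :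
    ∃ C, 0 ≤ C ∧ ∀ t s, 0 ≤ t → 0 ≤ s →
      N * (t + s) ≤ u (-t) * (t - s) + u (-s) * s + C := by
  obtain ⟨K₁, hK₁0, hK₁⟩ := hu.exists_le_on_neg (4 * N)
  obtain ⟨K₂, hK₂0, hK₂⟩ := hu.exists_two_mul_half_le
  set K := max K₁ K₂
  have hKK₁ : K₁ ≤ K := le_max_left _ _
  have hKK₂ : K₂ ≤ K := le_max_right _ _
  have hK0 : 0 ≤ K := hK₁0.trans hKK₁
  have hNK : 0 ≤ N * K := by positivity
  refine ⟨4 * (N * K), by positivity, fun t s ht hs => ?_⟩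
  have hut := hu.2.1 (-t)
  have hus := hu.2.1 (-s)
  have hanti : ∀ a b : ℝ, 0 ≤ a → a ≤ b → u (-a) ≤ u (-b) := fun a b ha hab =>
    hu.2.2.1 (by simp only [mem_Iic]; linarith) (by simp only [mem_Iic]; linarith) (by linarith)
  rcases le_total s t with hst | hts
  · have hNst : N * s ≤ N * t := mul_le_mul_of_nonneg_left hst hN
    have hNt : 0 ≤ N * t := by positivity
    have hts0 : 0 ≤ t - s := by linarith
    have hus_s : 0 ≤ u (-s) * s := by positivity
    rcases le_total t K with h | h
    · have : 0 ≤ u (-t) * (t - s) := by positivity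
      have : N * t ≤ N * K := mul_le_mul_of_nonneg_left h hN
      linarith
    · have h1 := mul_le_mul_of_nonneg_right (hK₁ t (hKK₁.trans h)) hts0
      rcases le_total s K with h' | h'
      · have : N * s ≤ N * K := mul_le_mul_of_nonneg_left h' hN
        linarith
      · have h2 := mul_le_mul_of_nonneg_right (hK₁ s (hKK₁.trans h')) hs
        linarith
  · have hNts : N * t ≤ N * s := mul_le_mul_of_nonneg_left hts hN
    have hst0 : 0 ≤ s - t := by linarith
    have h1 : u (-t) * (s - t) ≤ u (-s) * (s - t) :=
      mul_le_mul_of_nonneg_right (hanti t s ht hts) hst0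
    rcases le_total s K with h | h
    · have : N * s ≤ N * K := mul_le_mul_of_nonneg_left h hN
      have : 0 ≤ u (-s) * t := by positivity
      linarith
    · have h2 := mul_le_mul_of_nonneg_right (hK₁ s (hKK₁.trans h)) hs
      suffices u (-s) * s ≤ 2 * (u (-t) * (t - s) + u (-s) * s) by linarith
      rcases le_total (s / 2) t with h' | h'
      · have := mul_le_mul_of_nonneg_left h' hus
        linarith
      · have h3 : 2 * u (-t) ≤ u (-s) := by
          linarith [hanti t (s / 2) ht h', hK₂ s (hKK₂.trans h)]
        have := mul_le_mul_of_nonneg_right h3 hst0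
        have : 0 ≤ u (-s) * t := by positivity
        linarith

theorem drift_le (hu : Admissible u) {a b m δ : ℝ} (hm : 0 ≤ m) (hma : m ≤ a) (hmb : m ≤ b)
    (hδ : 0 < δ) :
    ∃ C, 0 ≤ C ∧ ∀ x y, (-a + u x) * x + (-b + u y - u x) * y ≤
      -m * (|x| + |y|) + δ * (|x| + |y|) + C := by
  obtain ⟨M, hM0, hM⟩ := hu.exists_bound_on_nonneg
  obtain ⟨C₁, hC₁0, hC₁⟩ := hu.mul_self_le_on_nonneg hδ
  set N := a + b + m + M with hNdef
  have hN : 0 ≤ N := by linarith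
  obtain ⟨C₂, hC₂0, hC₂⟩ := hu.linear_le_mul_self_on_neg hN
  obtain ⟨C₃, hC₃0, hC₃⟩ := hu.linear_le_on_neg_quadrant hN
  refine ⟨2 * C₁ + C₂ + C₃, by positivity, fun x y => ?_⟩
  have hux := hu.2.1 x
  rcases le_total 0 x with hx | hx <;> rcases le_total 0 y with hy | hy
  · rw [abs_of_nonneg hx, abs_of_nonneg hy]
    have := mul_le_mul_of_nonneg_right hma hx
    have := mul_le_mul_of_nonneg_right hmb hy
    have : 0 ≤ u x * y := by positivity
    linarith [hC₁ x hx, hC₁ y hy]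
  · rw [abs_of_nonneg hx, abs_of_nonpos hy]
    have hy' : 0 ≤ -y := by linarith
    have h1 := hC₂ (-y) hy'
    rw [neg_neg] at h1
    have := mul_le_mul_of_nonneg_right hma hx
    have := mul_le_mul_of_nonneg_right (hM x hx) hy'
    have : 0 ≤ a * -y := mul_nonneg (hm.trans hma) hy'
    have : 0 ≤ δ * -y := by positivity
    rw [hNdef] at h1
    linarith [hC₁ x hx]
  · rw [abs_of_nonpos hx, abs_of_nonneg hy]
    have hx' : 0 ≤ -x := by linarith
    have h1 := hC₂ (-x) hx'
    rw [neg_neg] at h1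
    have := mul_le_mul_of_nonneg_right hmb hy
    have : 0 ≤ u x * y := by positivity
    have : 0 ≤ (b + M) * -x := mul_nonneg (by linarith) hx'
    have : 0 ≤ δ * -x := by positivity
    rw [hNdef] at h1
    linarith [hC₁ y hy]
  · rw [abs_of_nonpos hx, abs_of_nonpos hy]
    have hx' : 0 ≤ -x := by linarith
    have hy' : 0 ≤ -y := by linarith
    have h1 := hC₃ (-x) (-y) hx' hy'
    rw [neg_neg, neg_neg] at h1
    have : 0 ≤ (b + M) * -x := mul_nonneg (by linarith) hx'
    have : 0 ≤ (a + M) * -y := mul_nonneg (by linarith) hy'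
    have : 0 ≤ δ * -x := by positivity
    have : 0 ≤ δ * -y := by positivity
    rw [hNdef] at h1
    linarith

end Admissible

theorem norm_le_abs_add_abs (x : EuclideanSpace ℝ (Fin 2)) : ‖x‖ ≤ |x 0| + |x 1| := by
  rw [EuclideanSpace.norm_eq, Fin.sum_univ_two]
  refine Real.sqrt_le_iff.2 ⟨by positivity, ?_⟩
  simp only [Real.norm_eq_abs]
  nlinarith [mul_nonneg (abs_nonneg (x 0)) (abs_nonneg (x 1))]

/-- Lemma 3.1: bound on `β₂` outside a large ball. -/
theorem beta2_bound (μ₁ μ₂ : ℝ) (hμ₁ : μ₁ < 0) (hμ₂ : μ₂ < 0)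
    (u : ℝ → ℝ) (hu : Admissible u) :
    ∀ ε > 0, ∃ R > 0, ∀ x : EuclideanSpace ℝ (Fin 2), R ≤ ‖x‖ →
      beta2 μ₁ μ₂ u x ≤ -(min |μ₁| |μ₂|) + ε := by
  intro ε hε
  obtain ⟨C, hC0, hC⟩ := hu.drift_le (m := min |μ₁| |μ₂|) (by positivity)
    (min_le_left _ _) (min_le_right _ _) (show 0 < ε / 4 by positivity)
  refine ⟨2 * C / ε + 1, by positivity, fun x hx => ?_⟩
  have hr : 0 < ‖x‖ := lt_of_lt_of_le (by positivity) hx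
  have hCr : C ≤ ε / 2 * ‖x‖ := by
    have : 2 * C / ε ≤ ‖x‖ := by linarith
    rw [div_le_iff₀ hε] at this
    linarith
  have h0 : |x 0| ≤ ‖x‖ := PiLp.norm_apply_le x 0
  have h1 : |x 1| ≤ ‖x‖ := PiLp.norm_apply_le x 1
  have hmain := hC (x 0) (x 1)
  rw [abs_of_neg hμ₁, abs_of_neg hμ₂, neg_neg, neg_neg] at hmain
  rw [beta2, one_div_mul_eq_div, div_le_iff₀ hr, abs_of_neg hμ₁, abs_of_neg hμ₂]
  have hm : 0 ≤ min (-μ₁) (-μ₂) := le_min (by linarith) (by linarith)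
  have := mul_le_mul_of_nonneg_left (norm_le_abs_add_abs x) hm
  have := mul_le_mul_of_nonneg_left (add_le_add h0 h1) (show 0 ≤ ε / 4 by positivity)
  linarith
end
end

section
/- Let d ≥ 1, let μ ∈ ℝ^d satisfy μ_i < 0 for all 1 ≤ i ≤ d, and let u be an admissible potential derivative. For every ε > 0 there exists R > 0 such that for every x ∈ ℝ^d with ‖x‖ ≥ R, β_d(x) ≤ −min_{1≤i≤d}|μ_i| + ε. -/
open Filter Real Set

noncomputable section

/-- `∑ k, (μ_k + u(x_k) − u(x_{k−1})) x_k` with the convention `u(x₀) := 0`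
(0-based indices: the first summand is `(μ₀ + u(x₀)) x₀`). -/
def betaSum {d : ℕ} (μ : Fin d → ℝ) (u : ℝ → ℝ) (x : Fin d → ℝ) : ℝ :=
  ∑ k, (μ k + u (x k) -
      (if (k : ℕ) = 0 then 0 else u (x ⟨(k : ℕ) - 1, lt_of_le_of_lt (Nat.sub_le _ _) k.isLt⟩)))
    * x k

/-- The drift functional `β_d(x)`. -/
def beta {d : ℕ} (μ : Fin d → ℝ) (u : ℝ → ℝ) (x : EuclideanSpace ℝ (Fin d)) : ℝ :=
  (1 / ‖x‖) * betaSum μ u x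

/-- Since `s ↦ u (-s)` is monotone on `[0, ∞)`, it is a subgradient of its primitive there. -/
lemma Admissible.subgradient {u : ℝ → ℝ} (hu : Admissible u) {y z : ℝ} (hy : 0 ≤ y) (hz : 0 ≤ z) :
    u (-z) * (y - z) ≤ (∫ s in (0 : ℝ)..y, u (-s)) - ∫ s in (0 : ℝ)..z, u (-s) := by
  have hc : Continuous fun s => u (-s) := hu.1.comp continuous_neg
  rw [intervalIntegral.integral_interval_sub_left (hc.intervalIntegrable _ _)
    (hc.intervalIntegrable _ _)]
  have hconst : ∀ a b : ℝ, ∫ _ in a..b, u (-z) = u (-z) * (b - a) := fun a b => by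
    rw [intervalIntegral.integral_const, smul_eq_mul, mul_comm]
  have hanti : ∀ {s t : ℝ}, 0 ≤ s → s ≤ t → u (-s) ≤ u (-t) := fun hs hst =>
    hu.2.2.1 (by simp; linarith) (by simpa using hs) (neg_le_neg hst)
  rcases le_total z y with h | h
  · rw [← hconst]
    exact intervalIntegral.integral_mono_on h (by simp) (hc.intervalIntegrable _ _)
      fun s hs => hanti hz hs.1
  · rw [intervalIntegral.integral_symm]
    have := intervalIntegral.integral_mono_on h (hc.intervalIntegrable _ _)
      (continuous_const.intervalIntegrable (μ := MeasureTheory.volume) _ _)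
      fun s hs => hanti (hy.trans hs.1) hs.2
    rw [hconst] at this
    linarith

/-- The subgradient inequality improved by a linear term, up to a constant. -/
lemma Admissible.subgradient_add {u : ℝ → ℝ} (hu : Admissible u) {C : ℝ} (hC : 0 ≤ C) :
    ∃ K : ℝ, 0 ≤ K ∧ ∀ y z : ℝ, 0 ≤ y → 0 ≤ z →
      u (-z) * (y - z) + C * z ≤
        (∫ s in (0 : ℝ)..y, u (-s)) - (∫ s in (0 : ℝ)..z, u (-s)) + 2 * C * y + K := by
  have hratio := (hu.2.2.2.2.2 1 (3 / 4) (by norm_num) (by norm_num)).eventually_ge_atTop 2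
  obtain ⟨N, hN⟩ := eventually_atBot.1 (hratio.and (hu.2.2.2.2.1.eventually_ge_atTop (8 * C)))
  refine ⟨C * |N|, by positivity, fun y z hy hz => ?_⟩
  have hsub := hu.subgradient hy hz
  rcases le_total z (2 * y) with h | h
  · have := mul_le_mul_of_nonneg_left h hC
    have : 0 ≤ C * |N| := by positivity
    linarith
  rcases le_total z |N| with h' | h'
  · have := mul_le_mul_of_nonneg_left h' hC
    have : 0 ≤ 2 * C * y := by positivity
    linarith
  obtain ⟨h1, h2⟩ := hN (-z) (by linarith [neg_abs_le N])
  rw [one_mul] at h1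
  have hpos : 0 < u (3 / 4 * -z) := by
    refine (hu.2.1 _).lt_of_ne fun h0 => ?_
    rw [← h0, div_zero] at h1
    norm_num at h1
  rw [le_div_iff₀ hpos, mul_neg] at h1
  have hz' : 0 ≤ 3 / 4 * z := by positivity
  have s1 := hu.subgradient hz' hz
  have s2 := hu.subgradient hy hz'
  have hprod : 4 * C * (z / 4) ≤ (u (-z) - u (-(3 / 4 * z))) * (3 / 4 * z - y) :=
    mul_le_mul (by linarith) (by linarith) (by positivity) (by linarith)
  have : 0 ≤ 2 * C * y := by positivity
  have : 0 ≤ C * |N| := by positivity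
  linarith

lemma Admissible.bounded_nonneg {u : ℝ → ℝ} (hu : Admissible u) :
    ∃ M : ℝ, 0 ≤ M ∧ ∀ p, 0 ≤ p → u p ≤ M := by
  obtain ⟨N, hN⟩ := eventually_atTop.1 (hu.2.2.2.1.eventually_le_const one_pos)
  obtain ⟨B, hB⟩ := (isCompact_Icc (a := (0 : ℝ)) (b := N)).bddAbove_image hu.1.continuousOn
  refine ⟨max 1 B, by positivity, fun p hp => ?_⟩
  rcases le_total N p with h | h
  · exact (hN p h).trans (le_max_left _ _)
  · exact (hB (mem_image_of_mem u ⟨hp, h⟩)).trans (le_max_right _ _)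

lemma Admissible.mul_self_le {u : ℝ → ℝ} (hu : Admissible u) {ε : ℝ} (hε : 0 < ε) :
    ∃ K : ℝ, 0 ≤ K ∧ ∀ p, 0 ≤ p → u p * p ≤ ε * p + K := by
  obtain ⟨M, hM, hb⟩ := hu.bounded_nonneg
  obtain ⟨N, hN⟩ := eventually_atTop.1 (hu.2.2.2.1.eventually_le_const hε)
  refine ⟨M * |N|, by positivity, fun p hp => ?_⟩
  rcases le_total |N| p with h | h
  · have := mul_le_mul_of_nonneg_right (hN p ((le_abs_self N).trans h)) hp
    have : 0 ≤ M * |N| := by positivity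
    linarith
  · have := mul_le_mul (hb p hp) h hp hM
    have : 0 ≤ ε * p := by positivity
    linarith

/-- The value of `u` at the previous term of a sequence, and `0` at the first index. -/
def prevValue (u : ℝ → ℝ) (X : ℕ → ℝ) : ℕ → ℝ
  | 0 => 0
  | k + 1 => u (X k)

/-- The interaction terms dominate every multiple of the negative parts. -/
lemma Admissible.interaction_le {u : ℝ → ℝ} (hu : Admissible u) {D ε : ℝ} (hD : 0 ≤ D)
    (hε : 0 < ε) (n : ℕ) :
    ∃ C K : ℝ, 0 ≤ C ∧ 0 ≤ K ∧ ∀ (X : ℕ → ℝ) (y : ℝ), 0 ≤ y →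
      ∑ k ∈ Finset.range n, (u (X k) - prevValue u X k) * X k + prevValue u X n * y ≤
        (∫ s in (0 : ℝ)..y, u (-s)) + C * y
          + ∑ k ∈ Finset.range n, (ε * max (X k) 0 - D * max (-X k) 0) + K := by
  have hU : ∀ y : ℝ, 0 ≤ y → 0 ≤ ∫ s in (0 : ℝ)..y, u (-s) := fun y hy =>
    intervalIntegral.integral_nonneg hy fun s _ => hu.2.1 _
  induction n with
  | zero => exact ⟨0, 0, le_rfl, le_rfl, fun X y hy => by simpa [prevValue] using hU y hy⟩
  | succ n ih =>
    obtain ⟨C, K, hC, hK, h⟩ := ih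
    obtain ⟨M, hM, hb⟩ := hu.bounded_nonneg
    obtain ⟨K₁, hK₁, h₁⟩ := hu.mul_self_le hε
    obtain ⟨K₂, hK₂, h₂⟩ := hu.subgradient_add (add_nonneg hC hD)
    refine ⟨2 * (C + D) + M, K + K₁ + K₂, by positivity, by positivity, fun X y hy => ?_⟩
    rw [Finset.sum_range_succ, Finset.sum_range_succ]
    have hprev : 0 ≤ prevValue u X n := by
      cases n with
      | zero => exact le_rfl
      | succ m => exact hu.2.1 _
    change _ + (u (X n) - prevValue u X n) * X n + u (X n) * y ≤ _
    rcases le_total 0 (X n) with hx | hx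
    · rw [max_eq_left hx, max_eq_right (neg_nonpos.2 hx)]
      have i0 := h X 0 le_rfl
      rw [intervalIntegral.integral_same] at i0
      have i1 := h₁ _ hx
      have i2 := mul_le_mul_of_nonneg_right (hb _ hx) hy
      have i3 := mul_nonneg hprev hx
      have i4 := hU y hy
      have i5 : 0 ≤ (C + D) * y := by positivity
      linarith
    · rw [max_eq_right hx, max_eq_left (neg_nonneg.2 hx)]
      have i0 := h X (-X n) (neg_nonneg.2 hx)
      have i1 := h₂ y (-X n) hy (neg_nonneg.2 hx)
      rw [neg_neg] at i1
      have i2 : 0 ≤ M * y := by positivity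
      linarith

/-- `betaSum` written as a sum over an initial segment of `ℕ`. -/
lemma betaSum_eq_sum_range {d : ℕ} (μ : Fin d → ℝ) (u : ℝ → ℝ) (x : Fin d → ℝ) (X : ℕ → ℝ)
    (hX : ∀ k : Fin d, X k = x k) :
    betaSum μ u x = ∑ k, μ k * x k +
      ∑ k ∈ Finset.range d, (u (X k) - prevValue u X k) * X k := by
  rw [Finset.sum_range, ← Finset.sum_add_distrib, betaSum]
  refine Finset.sum_congr rfl fun k _ => ?_
  rw [hX]
  obtain ⟨k, hk⟩ := k
  cases k with
  | zero => simp only [prevValue, if_true]; ring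
  | succ m =>
    have := hX ⟨m, by omega⟩
    simp only at this
    simp only [prevValue, this, Nat.add_sub_cancel, Nat.succ_ne_zero, if_false]
    ring

/-- Lemma 3.2, first part: `β_d(x) ≤ −min_i |μ_i| + ε` for `‖x‖` large enough. -/
theorem beta_bound (d : ℕ) (hd : 1 ≤ d) (μ : Fin d → ℝ) (hμ : ∀ i, μ i < 0)
    (u : ℝ → ℝ) (hu : Admissible u) :
    ∀ ε > 0, ∃ R > 0, ∀ x : EuclideanSpace ℝ (Fin d), R ≤ ‖x‖ →
      beta μ u x ≤ -(⨅ i, |μ i|) + ε := by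
  intro ε hε
  have : Nonempty (Fin d) := ⟨⟨0, hd⟩⟩
  set m : ℝ := ⨅ i, |μ i|
  have hmle : ∀ i, m ≤ |μ i| := fun i => ciInf_le (Set.finite_range _).bddBelow i
  have hm : 0 < m := by
    obtain ⟨i, hi⟩ := exists_eq_ciInf_of_finite (f := fun i => |μ i|)
    exact lt_of_lt_of_eq (abs_pos.2 (hμ i).ne) hi
  set M : ℝ := ∑ i, |μ i|
  have hM : ∀ i, |μ i| ≤ M := fun i =>
    Finset.single_le_sum (f := fun i => |μ i|) (fun _ _ => abs_nonneg _) (Finset.mem_univ i)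
  have hM0 : 0 ≤ M := Finset.sum_nonneg fun _ _ => abs_nonneg _
  set δ : ℝ := min (ε / 2) m
  have hδ : 0 < δ := lt_min (by positivity) hm
  obtain ⟨C, K, -, hK, h⟩ := hu.interaction_le (add_nonneg hM0 hm.le) hδ d
  refine ⟨2 * K / ε + 1, by positivity, fun x hx => ?_⟩
  have hx0 : 0 < ‖x‖ := lt_of_lt_of_le (by positivity) hx
  have hKx : K ≤ ε / 2 * ‖x‖ := by
    have : 2 * K / ε ≤ ‖x‖ := by linarith
    rw [div_le_iff₀ hε] at this
    linarith
  set X : ℕ → ℝ := fun k => if hk : k < d then x ⟨k, hk⟩ else 0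
  have hX : ∀ k : Fin d, X k = x k := fun k => by simp [X]
  have hint := h X 0 le_rfl
  rw [intervalIntegral.integral_same, mul_zero, mul_zero, Finset.sum_range
    (fun k => δ * max (X k) 0 - (M + m) * max (-X k) 0)] at hint
  simp only [hX] at hint
  have hterm : ∑ k, μ k * x k + ∑ k, (δ * max (x k) 0 - (M + m) * max (-x k) 0)
      ≤ -(m - δ) * ∑ k, |x k| := by
    rw [← Finset.sum_add_distrib, Finset.mul_sum]
    refine Finset.sum_le_sum fun k _ => ?_
    have hk := hmle k
    have hk' := hM k
    rw [abs_of_neg (hμ k)] at hk hk'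
    rcases le_total 0 (x k) with hp | hp
    · rw [max_eq_left hp, max_eq_right (neg_nonpos.2 hp), abs_of_nonneg hp]
      linarith [mul_le_mul_of_nonneg_right hk hp]
    · rw [max_eq_right hp, max_eq_left (neg_nonneg.2 hp), abs_of_nonpos hp]
      linarith [mul_le_mul_of_nonneg_right hk' (neg_nonneg.2 hp),
        mul_nonneg hδ.le (neg_nonneg.2 hp)]
  have hnorm := mul_le_mul_of_nonneg_left (EuclideanSpace.norm_le_sum_abs x)
    (sub_nonneg.2 (min_le_right (ε / 2) m))
  have hδx := mul_le_mul_of_nonneg_right (min_le_left (ε / 2) m) hx0.le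
  rw [beta, betaSum_eq_sum_range μ u x X hX, one_div, inv_mul_le_iff₀ hx0]
  linarith
end
end

section
/- Let d ≥ 1 and let u be an admissible potential derivative. For every M > 0 there exists R > 0 such that for every x ∈ ℝ^d with x_i < 0 for all 1 ≤ i ≤ d and ‖x‖ ≥ R, γ_d(x) ≤ −M; that is, γ_d(x) → −∞ as ‖x‖ → ∞ within the open negative orthant. -/
open Filter Real Set

noncomputable section

/-- `∑_{k=1}^{d−1} (x_k − x_{k+1}) u(x_k) + x_d u(x_d)`, written with 0-based indices:
the summand for the last index `k` (i.e. `(k : ℕ) + 1 = d`) is `x_k u(x_k)`. -/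
def gammaSum {d : ℕ} (u : ℝ → ℝ) (x : Fin d → ℝ) : ℝ :=
  ∑ k : Fin d,
    (x k - (if h : (k : ℕ) + 1 = d then 0 else x ⟨(k : ℕ) + 1, Nat.lt_of_le_of_ne k.isLt (fun he => h he)⟩))
      * u (x k)

/-- The functional `γ_d(x)`. -/
def gamma {d : ℕ} (u : ℝ → ℝ) (x : EuclideanSpace ℝ (Fin d)) : ℝ :=
  (1 / ‖x‖) * gammaSum u x

/-- For `u` antitone on `(-∞, 0]`, the endpoint rule at `a` bounds the (signed) integral of `u` from
`b` to `a` from below. -/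
lemma sub_mul_le_integral_sub_integral {u : ℝ → ℝ} (hc : Continuous u)
    (ha : AntitoneOn u (Set.Iic 0)) {a b : ℝ} (ha0 : a ≤ 0) (hb0 : b ≤ 0) :
    (a - b) * u a ≤ (∫ s in b..0, u s) - ∫ s in a..0, u s := by
  rw [← intervalIntegral.integral_add_adjacent_intervals (hc.intervalIntegrable b a)
    (hc.intervalIntegrable a 0), add_sub_cancel_right]
  rcases le_total a b with h | h
  · have hle := intervalIntegral.integral_mono_on (μ := MeasureTheory.volume) h
      (hc.intervalIntegrable a b) intervalIntegrable_const fun s hs => ha ha0 (hs.2.trans hb0) hs.1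
    rw [intervalIntegral.integral_const, smul_eq_mul] at hle
    rw [intervalIntegral.integral_symm]
    linarith
  · have hle := intervalIntegral.integral_mono_on (μ := MeasureTheory.volume) h
      intervalIntegrable_const (hc.intervalIntegrable b a) fun s hs => ha (hs.2.trans ha0) ha0 hs.2
    rwa [intervalIntegral.integral_const, smul_eq_mul] at hle

/-- The deficit of the endpoint rule grows faster than any linear function once `b ≤ 2 * a`. -/
lemma exists_sub_mul_sub_le {u : ℝ → ℝ} (hu : Admissible u) {K : ℝ} (hK : 0 ≤ K) :
    ∃ C, ∀ a b : ℝ, a ≤ 0 → b ≤ 0 →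
      (a - b) * u a - ((∫ s in b..0, u s) - ∫ s in a..0, u s) ≤ K * b - 2 * K * a + C := by
  obtain ⟨hc, -, hanti, -, hbot, hratio⟩ := hu
  have hr := (hratio (3 / 4) (1 / 2) (by norm_num) (by norm_num)).eventually_ge_atTop 2
  have hh : Tendsto (fun y : ℝ => 1 / 2 * y) atBot atBot :=
    tendsto_id.const_mul_atBot (by norm_num)
  have hl := (hbot.comp hh).eventually_ge_atTop (4 * K + 1)
  obtain ⟨B, hB⟩ := eventually_atBot.1 (hr.and hl)
  refine ⟨K * |B|, fun a b ha hb => ?_⟩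
  have hab := sub_mul_le_integral_sub_integral hc hanti ha hb
  have hKB : 0 ≤ K * |B| := by positivity
  rcases le_or_gt (2 * a) b with h | h
  · nlinarith [mul_nonneg hK (sub_nonneg.2 h)]
  have hKa : 0 ≤ K * -a := mul_nonneg hK (by linarith)
  rcases le_or_gt b B with hbB | hbB
  · obtain ⟨h1, h2⟩ := hB b hbB
    simp only [Function.comp_apply] at h2
    rw [le_div_iff₀ (by linarith)] at h1
    have h3 := sub_mul_le_integral_sub_integral hc hanti (a := 3 / 4 * b) (b := b) (by linarith) hb
    have h4 := sub_mul_le_integral_sub_integral hc hanti (a := a) (b := 3 / 4 * b) ha (by linarith)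
    have h5 : u a ≤ u (1 / 2 * b) :=
      hanti (Set.mem_Iic.2 (by linarith)) (Set.mem_Iic.2 ha) (by linarith)
    nlinarith [mul_nonneg (neg_nonneg.2 hb) (show 0 ≤ u (3 / 4 * b) - u a - 4 * K by linarith)]
  · nlinarith [mul_nonneg hK (show 0 ≤ b + |B| by linarith [neg_abs_le B])]

lemma gammaSum_succ_succ {d : ℕ} (u : ℝ → ℝ) (x : Fin (d + 2) → ℝ) :
    gammaSum u x = (x 0 - x 1) * u (x 0) + gammaSum u (fun i => x i.succ) := by
  unfold gammaSum
  rw [Fin.sum_univ_succ]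
  congr 1
  simp

/-- After adding the antiderivative at the first coordinate, `gammaSum` is controlled linearly by any
coordinate up to a multiple of the first one. -/
lemma exists_gammaSum_add_integral_le {u : ℝ → ℝ} (hu : Admissible u) {A : ℝ} (hA : 0 ≤ A)
    (d : ℕ) : ∃ C K : ℝ, 0 ≤ K ∧ ∀ x : Fin (d + 1) → ℝ, (∀ i, x i < 0) → ∀ i,
      gammaSum u x + ∫ s in (x 0)..0, u s ≤ A * x i + C - K * x 0 := by
  induction d with
  | zero =>
    refine ⟨0, A, hA, fun x hx i => ?_⟩
    have h := sub_mul_le_integral_sub_integral hu.1 hu.2.2.1 (hx 0).le le_rfl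
    rw [Fin.fin_one_eq_zero i]
    simp [gammaSum] at h ⊢
    linarith
  | succ d ih =>
    obtain ⟨C, K, hK, h⟩ := ih
    obtain ⟨C', hC'⟩ := exists_sub_mul_sub_le hu hK
    refine ⟨C + C', 2 * K + A, by positivity, fun x hx i => ?_⟩
    have h1 := hC' (x 0) (x 1) (hx 0).le (hx 1).le
    have h2 := h (fun i => x i.succ) fun i => hx _
    simp only [Fin.succ_zero_eq_one] at h2
    have h3 := mul_nonneg hA (neg_nonneg.2 (hx 0).le)
    rw [gammaSum_succ_succ]
    refine Fin.cases ?_ (fun j => ?_) i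
    · have h4 := h2 0
      simp only [Fin.succ_zero_eq_one] at h4
      have h5 := mul_nonneg hA (neg_nonneg.2 (hx 1).le)
      linarith
    · linarith [h2 j]

lemma exists_gammaSum_le {u : ℝ → ℝ} (hu : Admissible u) {A : ℝ} (hA : 0 ≤ A) (d : ℕ) :
    ∃ C : ℝ, ∀ x : Fin (d + 1) → ℝ, (∀ i, x i < 0) → ∀ i, gammaSum u x ≤ A * x i + C := by
  obtain ⟨C, K, hK, h⟩ := exists_gammaSum_add_integral_le hu hA d
  obtain ⟨C', hC'⟩ := exists_sub_mul_sub_le hu hK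
  refine ⟨C + C', fun x hx i => ?_⟩
  have h1 := hC' 0 (x 0) le_rfl (hx 0).le
  have h2 := mul_nonneg (neg_nonneg.2 (hx 0).le) (hu.2.1 0)
  simp only [intervalIntegral.integral_same] at h1
  linarith [h x hx i]

/-- `γ_d(x) → −∞` as `‖x‖ → ∞` within the open negative orthant. -/
theorem gamma_tendsto_neg_infty_on_negative_orthant (d : ℕ) (hd : 1 ≤ d)
    (u : ℝ → ℝ) (hu : Admissible u) :
    ∀ M > 0, ∃ R > 0, ∀ x : EuclideanSpace ℝ (Fin d), (∀ i, x i < 0) → R ≤ ‖x‖ →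
      gamma u x ≤ -M := by
  obtain ⟨d, rfl⟩ := Nat.exists_eq_add_of_le' hd
  intro M hM
  obtain ⟨C, hC⟩ := exists_gammaSum_le hu (A := (d + 1) * (M + 1)) (by positivity) d
  refine ⟨|C| + 1, by positivity, fun x hx hR => ?_⟩
  have hpos : 0 < ‖x‖ := by linarith [abs_nonneg C]
  have hsum : ∑ i : Fin (d + 1), gammaSum u x ≤ ∑ i, ((d + 1) * (M + 1) * x i + C) :=
    Finset.sum_le_sum fun i _ => hC x hx i
  have hnorm : ‖x‖ ≤ -∑ i, x i := by
    rw [← Finset.sum_neg_distrib]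
    exact (EuclideanSpace.norm_le_sum_abs x).trans_eq
      (Finset.sum_congr rfl fun i _ => abs_of_neg (hx i))
  rw [Finset.sum_add_distrib, ← Finset.mul_sum] at hsum
  simp only [Finset.sum_const, Finset.card_univ, Fintype.card_fin, nsmul_eq_mul, Nat.cast_add,
    Nat.cast_one, mul_assoc, ← mul_add] at hsum
  have hle := le_of_mul_le_mul_left hsum (by positivity)
  have hmul := mul_le_mul_of_nonneg_left hnorm (show 0 ≤ M + 1 by linarith)
  rw [gamma, one_div_mul_eq_div, div_le_iff₀ hpos]
  linarith [le_abs_self C]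
end
end

section
/- Let d ≥ 1 and let u : ℝ → ℝ satisfy u(y) ≥ 0 for all y and u nonincreasing on (−∞, 0]. If x ∈ ℝ^d satisfies x₁ ≤ x₂ ≤ ⋯ ≤ x_d ≤ 0 and x ≠ 0, then ∑_{k=1}^{d−1}(x_k − x_{k+1})u(x_k) + x_d u(x_d) ≤ x₁ u(x_d), and consequently γ_d(x) ≤ −u(x_d)/√d. -/
open Filter Real Set

noncomputable section

/-- The coefficients of `gammaSum` telescope to the first coordinate. -/
lemma sum_sub_next_eq_first {d : ℕ} (hd : 1 ≤ d) (x : Fin d → ℝ) :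
    ∑ k : Fin d, (x k - (if h : (k : ℕ) + 1 = d then 0 else
      x ⟨(k : ℕ) + 1, Nat.lt_of_le_of_ne k.isLt (fun he => h he)⟩)) = x ⟨0, hd⟩ := by
  let f : ℕ → ℝ := fun k => if h : k < d then x ⟨k, h⟩ else 0
  have hterm : ∀ k : Fin d, (x k - (if h : (k : ℕ) + 1 = d then 0 else
      x ⟨(k : ℕ) + 1, Nat.lt_of_le_of_ne k.isLt (fun he => h he)⟩)) = f k - f (k + 1) := by
    intro k
    by_cases h : (k : ℕ) + 1 = d
    · simp [f, h]
    · have h' : (k : ℕ) + 1 < d := Nat.lt_of_le_of_ne k.isLt h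
      simp [f, h, h']
  rw [Finset.sum_congr rfl fun k _ => hterm k,
    Fin.sum_univ_eq_sum_range (fun k => f k - f (k + 1)) d, Finset.sum_range_sub']
  simp [f, Nat.lt_of_succ_le hd]

lemma gammaSum_le_first_mul {d : ℕ} (hd : 1 ≤ d) {u : ℝ → ℝ} (hu : AntitoneOn u (Set.Iic 0))
    {x : Fin d → ℝ} (hmono : Monotone x)
    (hlast : x ⟨d - 1, Nat.sub_lt hd Nat.one_pos⟩ ≤ 0) :
    gammaSum u x ≤ x ⟨0, hd⟩ * u (x ⟨d - 1, Nat.sub_lt hd Nat.one_pos⟩) := by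
  rw [← sum_sub_next_eq_first hd x, Finset.sum_mul, gammaSum]
  refine Finset.sum_le_sum fun k _ => ?_
  by_cases h : (k : ℕ) + 1 = d
  · have hk : k = ⟨d - 1, Nat.sub_lt hd Nat.one_pos⟩ := Fin.ext (by simp; omega)
    rw [← hk]
  · have hk : x k ≤ x ⟨d - 1, Nat.sub_lt hd Nat.one_pos⟩ :=
      hmono (Fin.mk_le_mk.mpr (by omega) : k ≤ ⟨d - 1, Nat.sub_lt hd Nat.one_pos⟩)
    rw [dif_neg h]
    refine mul_le_mul_of_nonpos_left (hu (hk.trans hlast) hlast hk) (sub_nonpos.mpr (hmono ?_))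
    exact Fin.le_def.mpr (Nat.le_succ _)

lemma norm_le_sqrt_card_mul_of_abs_le {ι : Type*} [Fintype ι] (x : EuclideanSpace ℝ ι)
    {c : ℝ} (hc : 0 ≤ c) (h : ∀ i, |x i| ≤ c) : ‖x‖ ≤ √(Fintype.card ι) * c := by
  rw [EuclideanSpace.norm_eq]
  refine Real.sqrt_le_iff.mpr ⟨by positivity, ?_⟩
  rw [mul_pow, Real.sq_sqrt (Nat.cast_nonneg _)]
  calc ∑ i, ‖x i‖ ^ 2 ≤ ∑ _i : ι, c ^ 2 :=
        Finset.sum_le_sum fun i _ => pow_le_pow_left₀ (norm_nonneg _) (h i) 2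
    _ = Fintype.card ι * c ^ 2 := by simp

/-- For ordered nonpositive configurations `x₁ ≤ ⋯ ≤ x_d ≤ 0`, one has
`∑_{k=1}^{d−1}(x_k − x_{k+1})u(x_k) + x_d u(x_d) ≤ x₁ u(x_d)` and
`γ_d(x) ≤ −u(x_d)/√d`. -/
theorem gammaSum_le_of_monotone_nonpos (d : ℕ) (hd : 1 ≤ d)
    (u : ℝ → ℝ) (hu0 : ∀ y, 0 ≤ u y) (humono : AntitoneOn u (Set.Iic 0))
    (x : EuclideanSpace ℝ (Fin d)) (hmono : Monotone x)
    (hlast : x ⟨d - 1, Nat.sub_lt hd Nat.one_pos⟩ ≤ 0) (hx : x ≠ 0) :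
    gammaSum u x ≤ x ⟨0, hd⟩ * u (x ⟨d - 1, Nat.sub_lt hd Nat.one_pos⟩) ∧
      gamma u x ≤ -(u (x ⟨d - 1, Nat.sub_lt hd Nat.one_pos⟩)) / Real.sqrt d := by
  have hsum := gammaSum_le_first_mul hd humono hmono hlast
  refine ⟨hsum, ?_⟩
  have hnonpos : ∀ i, x i ≤ 0 := fun i =>
    (hmono (Fin.le_def.mpr (by simp; omega) : i ≤ ⟨d - 1, Nat.sub_lt hd Nat.one_pos⟩)).trans hlast
  have hnorm : ‖x‖ ≤ √d * -x ⟨0, hd⟩ := by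
    simpa only [Fintype.card_fin] using norm_le_sqrt_card_mul_of_abs_le x
      (neg_nonneg.mpr (hnonpos ⟨0, hd⟩)) fun i => by
        rw [abs_of_nonpos (hnonpos i)]
        exact neg_le_neg (hmono (Fin.le_def.mpr (Nat.zero_le _)))
  have hxpos : 0 < ‖x‖ := norm_pos_iff.mpr hx
  have hdpos : 0 < √(d : ℝ) := Real.sqrt_pos.mpr (by exact_mod_cast hd)
  rw [gamma, one_div_mul_eq_div, div_le_div_iff₀ hxpos hdpos]
  have hscaled := mul_le_mul_of_nonneg_right hsum hdpos.le
  have hbound := mul_le_mul_of_nonneg_right hnorm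
    (hu0 (x ⟨d - 1, Nat.sub_lt hd Nat.one_pos⟩))
  linarith
end
end

section
/- Let d ≥ 1, let μ ∈ ℝ^d satisfy μ_i < 0 for all 1 ≤ i ≤ d, and let u be an admissible potential derivative. Then there exists K > 0 such that for all x ∈ ℝ^d, ∑_{i=1}^d x_i·(μ_i + u(x_i) − u(x_{i−1})) ≤ K(1 + ‖x‖²), with the convention u(x₀) := 0 (the Khasminskii non-explosion condition for the drift of the GRBM with tridiagonal reflection). -/
open Filter Real Set

noncomputable section

/-- An antitone continuous function on `ℝ` admits a primitive vanishing at `0`, for which it is a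
supergradient. -/
theorem Antitone.exists_supergradient_primitive {w : ℝ → ℝ} (hw : Antitone w)
    (hc : Continuous w) :
    ∃ U : ℝ → ℝ, U 0 = 0 ∧ ∀ a b, U b ≤ U a + w a * (b - a) := by
  refine ⟨fun y => ∫ t in (0 : ℝ)..y, w t, by simp, fun a b => ?_⟩
  have hint : ∀ p q : ℝ, IntervalIntegrable w MeasureTheory.volume p q :=
    fun p q => hc.intervalIntegrable p q
  have hadd := intervalIntegral.integral_add_adjacent_intervals (hint 0 a) (hint a b)
  have hle : ∫ t in a..b, w t ≤ w a * (b - a) := by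
    rcases le_total a b with h | h
    · have := intervalIntegral.integral_mono_on h (hint a b) (intervalIntegrable_const (c := w a))
        (fun t ht => hw ht.1)
      simp only [intervalIntegral.integral_const, smul_eq_mul] at this
      linarith
    · have := intervalIntegral.integral_mono_on h (intervalIntegrable_const (c := w a)) (hint b a)
        (fun t ht => hw ht.2)
      simp only [intervalIntegral.integral_const, smul_eq_mul] at this
      rw [intervalIntegral.integral_symm]
      linarith
  simp only
  linarith

theorem Fin.sum_succ_sub_castSucc {n : ℕ} (g : Fin (n + 1) → ℝ) :
    ∑ i : Fin n, (g i.succ - g i.castSucc) = g (Fin.last n) - g 0 := by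
  have h := Fin.sum_univ_succ g
  rw [Fin.sum_univ_castSucc] at h
  rw [Finset.sum_sub_distrib]
  linarith

/-- A discrete integration by parts bound for antitone continuous functions. -/
theorem Antitone.sum_mul_sub_le {w : ℝ → ℝ} (hw : Antitone w) (hc : Continuous w) {n : ℕ}
    (x : Fin (n + 1) → ℝ) :
    x 0 * w (x 0) + ∑ i : Fin n, x i.succ * (w (x i.succ) - w (x i.castSucc)) ≤ w 0 * x 0 := by
  obtain ⟨U, hU0, hU⟩ := hw.exists_supergradient_primitive hc
  have hsum : ∑ i : Fin n, x i.succ * (w (x i.succ) - w (x i.castSucc)) ≤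
      ∑ i : Fin n, ((x i.succ * w (x i.succ) - U (x i.succ)) -
        (x i.castSucc * w (x i.castSucc) - U (x i.castSucc))) := by
    refine Finset.sum_le_sum fun i _ => ?_
    linarith [hU (x i.castSucc) (x i.succ)]
  rw [Fin.sum_succ_sub_castSucc (fun i => x i * w (x i) - U (x i))] at hsum
  linarith [hU 0 (x 0), hU (x (Fin.last n)) 0]

/-- An admissible potential derivative is at bounded distance from a nonnegative antitone
continuous function. -/
theorem Admissible.exists_antitone_approx {u : ℝ → ℝ} (hu : Admissible u) :
    ∃ w : ℝ → ℝ, Antitone w ∧ Continuous w ∧ 0 ≤ w 0 ∧ ∃ M, 0 ≤ M ∧ ∀ y, |u y - w y| ≤ M := by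
  obtain ⟨hc, hnn, hanti, htop, -, -⟩ := hu
  obtain ⟨A, hA⟩ := eventually_atTop.1 (htop.eventually (eventually_le_nhds zero_lt_one))
  obtain ⟨B, hB⟩ := (isCompact_Icc (a := (0 : ℝ)) (b := A)).bddAbove_image hc.continuousOn
  have hbd : ∀ y, 0 ≤ y → u y ≤ max 1 B := fun y hy => by
    rcases le_total A y with h | h
    · exact (hA y h).trans (le_max_left _ _)
    · exact (hB ⟨y, ⟨hy, h⟩, rfl⟩).trans (le_max_right _ _)
  have hM : (0 : ℝ) ≤ max 1 B := zero_le_one.trans (le_max_left _ _)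
  refine ⟨fun y => u (min y 0), ?_, by fun_prop, hnn _, max 1 B, hM, fun y => ?_⟩
  · exact fun a b h => hanti (mem_Iic.2 (min_le_right _ _)) (mem_Iic.2 (min_le_right _ _)) (min_le_min_right 0 h)
  · rcases le_total y 0 with h | h
    · simp [min_eq_left h]
    · simp only [min_eq_right h]
      rw [abs_le]
      constructor <;> linarith [hbd y h, hbd 0 le_rfl, hnn y, hnn 0]

/-- The Khasminskii non-explosion condition for the drift of the GRBM with
tridiagonal reflection. -/
theorem khasminskii_condition (d : ℕ) (hd : 1 ≤ d) (μ : Fin d → ℝ) (hμ : ∀ i, μ i < 0)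
    (u : ℝ → ℝ) (hu : Admissible u) :
    ∃ K > 0, ∀ x : EuclideanSpace ℝ (Fin d),
      ∑ i, x i * driftCoeff μ u x i ≤ K * (1 + ‖x‖ ^ 2) := by
  obtain ⟨n, rfl⟩ : ∃ n, d = n + 1 := ⟨d - 1, by omega⟩
  obtain ⟨w, hw, hwc, hw0, M, hM, huw⟩ := hu.exists_antitone_approx
  have hC : 0 ≤ ∑ i, (|μ i| + 2 * M) := Finset.sum_nonneg fun i _ => by positivity
  refine ⟨∑ i, (|μ i| + 2 * M) + w 0 + 1, by linarith, fun x => ?_⟩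
  have hx : ∀ i, |x i| ≤ 1 + ‖x‖ ^ 2 := fun i => by
    have := PiLp.norm_apply_le x i
    rw [Real.norm_eq_abs] at this
    nlinarith [sq_nonneg (‖x‖ - 1), sq_nonneg ‖x‖]
  have hterm : ∀ i, x i * driftCoeff μ u x i ≤
      x i * driftCoeff 0 w x i + (|μ i| + 2 * M) * (1 + ‖x‖ ^ 2) := fun i => by
    have hdiff : |driftCoeff μ u x i - driftCoeff 0 w x i| ≤ |μ i| + 2 * M := by
      have h1 := abs_le.1 (huw (x i))
      have h2 := neg_abs_le (μ i)
      have h3 := le_abs_self (μ i)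
      unfold driftCoeff
      rw [Pi.zero_apply, abs_le]
      split_ifs
      · constructor <;> linarith
      · have h4 := abs_le.1 (huw (x ⟨(i : ℕ) - 1, lt_of_le_of_lt (Nat.sub_le _ _) i.isLt⟩))
        constructor <;> linarith
    have hprod : x i * (driftCoeff μ u x i - driftCoeff 0 w x i) ≤
        (|μ i| + 2 * M) * (1 + ‖x‖ ^ 2) := by
      refine (le_abs_self _).trans ?_
      rw [abs_mul, mul_comm]
      exact mul_le_mul hdiff (hx i) (abs_nonneg _) (by positivity)
    linarith
  have hmain : ∑ i, x i * driftCoeff 0 w x i ≤ w 0 * x 0 := by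
    refine le_trans (le_of_eq ?_) (hw.sum_mul_sub_le hwc x)
    rw [Fin.sum_univ_succ]
    simp [driftCoeff, Fin.castSucc, Fin.castAdd, Fin.castLE]
  have hsum := Finset.sum_le_sum fun i (_ : i ∈ Finset.univ) => hterm i
  rw [Finset.sum_add_distrib, ← Finset.sum_mul] at hsum
  have h0 : w 0 * x 0 ≤ w 0 * (1 + ‖x‖ ^ 2) :=
    mul_le_mul_of_nonneg_left ((le_abs_self _).trans (hx 0)) hw0
  nlinarith [sq_nonneg ‖x‖]
end
end

section
/- Let d ≥ 1, let Γ be a symmetric d×d real matrix with spectral norm ‖Γ‖, let μ ∈ ℝ^d, let u : ℝ → ℝ, let λ > 0 and ε ≥ 0. Let ψ : ℝ^d → ℝ be twice continuously differentiable and let x ∈ ℝ^d be a point at which the gradient satisfies ‖∇ψ(x)‖ ≤ 1 and the Hessian D²ψ(x) has operator norm at most ε. Set V := exp(λψ). Then (1/2)∑_{i,j=1}^d Γ_{ij} ∂²V/∂x_i∂x_j(x) + ∑_{i=1}^d (μ_i + u(x_i) − u(x_{i−1})) ∂V/∂x_i(x) ≤ [ (1/2)d‖Γ‖(λ² + λε)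 + λ·∑_{i=1}^d (μ_i + u(x_i) − u(x_{i−1})) ∂ψ/∂x_i(x) ]·V(x), with the convention u(x₀) := 0. -/
open Filter Real Set

noncomputable section

/-- A bilinear form contracted with a matrix is bounded by `d` times the product of the norms. -/
theorem sum_mul_bilin_le {d : ℕ} (Γ : Matrix (Fin d) (Fin d) ℝ)
    (B : EuclideanSpace ℝ (Fin d) →L[ℝ] EuclideanSpace ℝ (Fin d) →L[ℝ] ℝ) :
    ∑ i, ∑ j, Γ i j * B (EuclideanSpace.single i (1:ℝ)) (EuclideanSpace.single j (1:ℝ)) ≤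
      d * (‖B‖ * ‖Matrix.toEuclideanCLM (𝕜 := ℝ) Γ‖) := by
  have hcol (j : Fin d) : Matrix.toEuclideanCLM (𝕜 := ℝ) Γ (EuclideanSpace.single j (1:ℝ)) =
      ∑ i, Γ i j • EuclideanSpace.single i (1:ℝ) := by
    ext k
    simp [Matrix.ofLp_toEuclideanCLM, Pi.single_apply]
  have hterm (j : Fin d) : ∑ i, Γ i j *
      B (EuclideanSpace.single i (1:ℝ)) (EuclideanSpace.single j (1:ℝ)) ≤
        ‖B‖ * ‖Matrix.toEuclideanCLM (𝕜 := ℝ) Γ‖ := by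
    calc _ = B (Matrix.toEuclideanCLM (𝕜 := ℝ) Γ (EuclideanSpace.single j (1:ℝ)))
          (EuclideanSpace.single j (1:ℝ)) := by
          rw [hcol]
          simp
      _ ≤ ‖B‖ * ‖Matrix.toEuclideanCLM (𝕜 := ℝ) Γ (EuclideanSpace.single j (1:ℝ))‖ *
          ‖EuclideanSpace.single j (1:ℝ)‖ := (le_abs_self _).trans (B.le_opNorm₂ _ _)
      _ ≤ ‖B‖ * ‖Matrix.toEuclideanCLM (𝕜 := ℝ) Γ‖ := by
          have := (Matrix.toEuclideanCLM (𝕜 := ℝ) Γ).le_opNorm (EuclideanSpace.single j (1:ℝ))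
          simp only [PiLp.norm_single, norm_one, mul_one] at this ⊢
          gcongr
  rw [Finset.sum_comm]
  calc _ ≤ ∑ _j : Fin d, ‖B‖ * ‖Matrix.toEuclideanCLM (𝕜 := ℝ) Γ‖ :=
        Finset.sum_le_sum fun j _ => hterm j
    _ = _ := by simp

section ExpDerivatives

variable {E : Type*} [NormedAddCommGroup E] [NormedSpace ℝ E]

theorem fderiv_exp_const_mul {ψ : E → ℝ} {x : E} (hψ : DifferentiableAt ℝ ψ x) (l : ℝ) :
    fderiv ℝ (fun y => Real.exp (l * ψ y)) x = (Real.exp (l * ψ x) * l) • fderiv ℝ ψ x := by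
  rw [((hψ.hasFDerivAt.const_mul l).exp).fderiv, smul_smul]

theorem fderiv_fderiv_exp_const_mul_apply {ψ : E → ℝ} (hψ : ContDiff ℝ 2 ψ) (l : ℝ) (x v w : E) :
    fderiv ℝ (fun y => fderiv ℝ (fun z => Real.exp (l * ψ z)) y v) x w =
      (l ^ 2 * (fderiv ℝ ψ x w * fderiv ℝ ψ x v) + l * fderiv ℝ (fderiv ℝ ψ) x w v) *
        Real.exp (l * ψ x) := by
  have hd : Differentiable ℝ ψ := hψ.differentiable (by norm_num)
  have hd' : Differentiable ℝ (fderiv ℝ ψ) :=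
    (hψ.fderiv_right (m := 1) (by norm_num)).differentiable (by norm_num)
  have hfun : (fun y => fderiv ℝ (fun z => Real.exp (l * ψ z)) y v) =
      fun y => Real.exp (l * ψ y) * l * fderiv ℝ ψ y v := by
    funext y
    simp [fderiv_exp_const_mul (hd y)]
  have hexp := (((hd x).hasFDerivAt.const_mul l).exp).mul_const l
  have hgrad := (hd' x).hasFDerivAt.clm_apply (hasFDerivAt_const v x)
  rw [hfun, (hexp.fun_mul hgrad).fderiv]
  simp
  ring

set_option maxSynthPendingDepth 3 in
theorem norm_sq_smul_smulRight_add_smul_le {g : E →L[ℝ] ℝ} {H : E →L[ℝ] E →L[ℝ] ℝ} {l ε : ℝ}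
    (hl : 0 ≤ l) (hg : ‖g‖ ≤ 1) (hH : ‖H‖ ≤ ε) :
    ‖l ^ 2 • g.smulRight g + l • H‖ ≤ l ^ 2 + l * ε := by
  calc _ ≤ ‖l ^ 2 • g.smulRight g‖ + ‖l • H‖ := norm_add_le _ _
    _ = l ^ 2 * (‖g‖ * ‖g‖) + l * ‖H‖ := by
        rw [norm_smul, norm_smul, ContinuousLinearMap.norm_smulRight_apply,
          Real.norm_of_nonneg hl, Real.norm_of_nonneg (sq_nonneg l)]
    _ ≤ l ^ 2 * (1 * 1) + l * ε := by gcongr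
    _ = l ^ 2 + l * ε := by ring

end ExpDerivatives

/-- Pointwise bound on the generator applied to `V = exp(λψ)` at a point where
`‖∇ψ(x)‖ ≤ 1` and `‖D²ψ(x)‖ ≤ ε`. -/
theorem generator_exp_bound (d : ℕ) (hd : 1 ≤ d)
    (Γ : Matrix (Fin d) (Fin d) ℝ) (hΓsym : Γ.IsSymm)
    (μ : Fin d → ℝ) (u : ℝ → ℝ) (l : ℝ) (hl : 0 < l) (ε : ℝ) (hε : 0 ≤ ε)
    (ψ : EuclideanSpace ℝ (Fin d) → ℝ) (hψ : ContDiff ℝ 2 ψ)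
    (x : EuclideanSpace ℝ (Fin d))
    (hgrad : ‖fderiv ℝ ψ x‖ ≤ 1) (hhess : ‖fderiv ℝ (fderiv ℝ ψ) x‖ ≤ ε) :
    generator Γ μ u (fun y => Real.exp (l * ψ y)) x ≤
      ((1/2) * d * ‖Matrix.toEuclideanCLM (𝕜 := ℝ) Γ‖ * (l ^ 2 + l * ε)
          + l * ∑ i, driftCoeff μ u x i * fderiv ℝ ψ x (EuclideanSpace.single i (1:ℝ)))
        * Real.exp (l * ψ x) := by
  have hd1 : Differentiable ℝ ψ := hψ.differentiable (by norm_num)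
  set g := fderiv ℝ ψ x with hg
  set H := fderiv ℝ (fderiv ℝ ψ) x with hH
  set B := l ^ 2 • g.smulRight g + l • H with hB
  have hBnorm : ‖B‖ ≤ l ^ 2 + l * ε :=
      norm_sq_smul_smulRight_add_smul_le hl.le hgrad hhess
  have hgen : generator Γ μ u (fun y => Real.exp (l * ψ y)) x =
      ((1/2) * ∑ i, ∑ j, Γ i j *
          B (EuclideanSpace.single i (1:ℝ)) (EuclideanSpace.single j (1:ℝ))
        + l * ∑ i, driftCoeff μ u x i * g (EuclideanSpace.single i (1:ℝ)))
        * Real.exp (l * ψ x) := by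
    simp only [generator, fderiv_fderiv_exp_const_mul_apply hψ, fderiv_exp_const_mul (hd1 x),
      add_mul, Finset.mul_sum, Finset.sum_mul]
    congr 1
    · refine Finset.sum_congr rfl fun i _ => Finset.sum_congr rfl fun j _ => ?_
      simp [hB, hg, hH]
      ring
    · refine Finset.sum_congr rfl fun i _ => ?_
      simp [hg]
      ring
  rw [hgen]
  have hsum := sum_mul_bilin_le Γ B
  have hbound : (d : ℝ) * (‖B‖ * ‖Matrix.toEuclideanCLM (𝕜 := ℝ) Γ‖) ≤
      d * ((l ^ 2 + l * ε) * ‖Matrix.toEuclideanCLM (𝕜 := ℝ) Γ‖) := by gcongr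
  refine mul_le_mul_of_nonneg_right ?_ (Real.exp_pos _).le
  linarith
end
end

section
/- Let d ≥ 2, let μ̃ ∈ ℝ^{d−1} satisfy μ̃_i < 0 for all 1 ≤ i ≤ d−1, let u be an admissible potential derivative, and let Γ be the (d−1)×(d−1) matrix with Γ_{jj} = 2, Γ_{j,j+1} = Γ_{j+1,j} = −1, and Γ_{jk} = 0 for |j − k| ≥ 2. Then there exist b < ∞, r > 0, and a norm-like function V : ℝ^{d−1} → [1, ∞) such that for all x ∈ ℝ^{d−1}, (1/2)∑_{i,j=1}^{d−1} Γ_{ij} ∂²V/∂x_i∂x_j(x) + ∑_{i=1}^{d−1} (μ̃_i + u(x_i) − u(x_{i−1})) ∂V/∂x_i(x) ≤ −K^s·V(x) + b·1_{{‖x‖ ≤ r}}(x), where K^s := min_{1≤i≤d−1} μ̃_i² / (4d(1 + cos(π/d))) and the convention u(x₀) := 0 is used. -/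
open Filter Real Set

noncomputable section

/-- The covariance matrix of the gap process: the symmetric tridiagonal Toeplitz matrix with
diagonal entries `2` and off-diagonal entries `−1`. -/
def gapGamma (m : ℕ) : Matrix (Fin m) (Fin m) ℝ :=
  Matrix.of fun j k =>
    if j = k then 2 else if (j : ℕ) + 1 = (k : ℕ) ∨ (k : ℕ) + 1 = (j : ℕ) then -1 else 0

lemma Admissible.exists_bound_of_ge {u : ℝ → ℝ} (hu : Admissible u) (R : ℝ) :
    ∃ B, 0 ≤ B ∧ ∀ y, R ≤ y → u y ≤ B := by
  obtain ⟨hc, -, -, ht, -, -⟩ := hu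
  obtain ⟨N, hN⟩ := eventually_atTop.1 (ht.eventually (eventually_le_nhds (zero_lt_one (α := ℝ))))
  obtain ⟨B, hB⟩ := (isCompact_Icc (a := R) (b := N)).exists_bound_of_continuousOn hc.continuousOn
  refine ⟨max B 1, by positivity, fun y hy => ?_⟩
  rcases le_total N y with h | h
  · exact (hN y h).trans (le_max_right _ _)
  · exact ((le_abs_self _).trans (hB y ⟨hy, h⟩)).trans (le_max_left _ _)

lemma Admissible.exists_mul_le_of_nonneg {u : ℝ → ℝ} (hu : Admissible u) {η : ℝ} (hη : 0 < η) :
    ∃ C, 0 ≤ C ∧ ∀ x, 0 ≤ x → u x * x ≤ η * x + C := by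
  obtain ⟨B, hB0, hB⟩ := hu.exists_bound_of_ge 0
  obtain ⟨N, hN⟩ := eventually_atTop.1 (hu.2.2.2.1.eventually (eventually_le_nhds hη))
  refine ⟨B * |N|, by positivity, fun x hx => ?_⟩
  rcases le_total N x with h | h
  · have := mul_le_mul_of_nonneg_right (hN x h) hx
    have : 0 ≤ B * |N| := by positivity
    linarith
  · have := mul_le_mul (hB x hx) (h.trans (le_abs_self N)) hx hB0
    have : 0 ≤ η * x := by positivity
    linarith

lemma Admissible.exists_negPart_le {u : ℝ → ℝ} (hu : Admissible u) {M η : ℝ} (hM : 0 ≤ M)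
    (hη : 0 < η) :
    ∃ C, 0 ≤ C ∧ ∀ y, M * max (-y) 0 ≤ η * (max (-y) 0 * u y) + C := by
  obtain ⟨N, hN⟩ := eventually_atBot.1 (hu.2.2.2.2.1.eventually (eventually_ge_atTop (M / η)))
  refine ⟨M * |N|, by positivity, fun y => ?_⟩
  have hy0 : 0 ≤ max (-y) 0 := le_max_right _ _
  rcases le_total y N with h | h
  · have h1 := (div_le_iff₀ hη).1 (hN y h)
    have h2 := mul_le_mul_of_nonneg_right h1 hy0
    have : 0 ≤ M * |N| := by positivity
    linarith
  · have h1 : max (-y) 0 ≤ |N| := max_le (by linarith [neg_abs_le N]) (abs_nonneg _)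
    have h2 := mul_le_mul_of_nonneg_left h1 hM
    have h3 : 0 ≤ η * (max (-y) 0 * u y) := mul_nonneg hη.le (mul_nonneg hy0 (hu.2.1 y))
    linarith

lemma Admissible.exists_mul_rescaled_le {u : ℝ → ℝ} (hu : Admissible u) {θ M η : ℝ} (hθ : 0 < θ)
    (hθ1 : θ < 1) (hM : 0 < M) (hη : 0 < η) :
    ∃ C, 0 ≤ C ∧ ∀ y, y ≤ 0 → M * (-y * u (θ * y)) ≤ η * (-y * u y) + C := by
  obtain ⟨N, hN⟩ := eventually_atBot.1
    ((hu.2.2.2.2.2 1 θ hθ hθ1).eventually (eventually_ge_atTop (M / η)))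
  obtain ⟨B, hB0, hB⟩ := hu.exists_bound_of_ge (θ * N)
  refine ⟨M * (|N| * B), by positivity, fun y hy => ?_⟩
  have hC : 0 ≤ M * (|N| * B) := by positivity
  rcases le_total y N with h | h
  · have h1 := hN y h
    rw [one_mul] at h1
    have hpos : 0 < u (θ * y) := by
      refine lt_of_le_of_ne (hu.2.1 _) fun h0 => ?_
      rw [← h0, div_zero] at h1
      exact absurd h1 (not_le.2 (by positivity))
    rw [div_le_div_iff₀ hη hpos] at h1
    have := mul_le_mul_of_nonneg_right h1 (neg_nonneg.2 hy)
    linarith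
  · have h1 : -y ≤ |N| := by linarith [neg_abs_le N]
    have h2 := mul_le_mul h1 (hB (θ * y) (mul_le_mul_of_nonneg_left h hθ.le)) (hu.2.1 _)
      (abs_nonneg N)
    have h3 := mul_le_mul_of_nonneg_left h2 hM.le
    have h4 : 0 ≤ η * (-y * u y) := mul_nonneg hη.le (mul_nonneg (neg_nonneg.2 hy) (hu.2.1 y))
    linarith

/-- The interaction of two neighbouring gaps `x`, `y` weighted by `a > b`. -/
lemma Admissible.exists_interaction_le {u : ℝ → ℝ} (hu : Admissible u) {a b δ η : ℝ} (hb : 0 < b)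
    (hδ : 0 < δ) (hab : b + 2 * δ ≤ a) (hη : 0 < η) :
    ∃ C, 0 ≤ C ∧ ∀ x y, u x * (a * x - b * y) ≤
      -δ * (max (-x) 0 * u x) + η * (max (-y) 0 * u y) + η * |x| + C := by
  have ha : 0 < a := by linarith
  obtain ⟨C₁, hC₁, h₁⟩ := hu.exists_mul_le_of_nonneg (η := η / a) (by positivity)
  obtain ⟨B, hB0, hB⟩ := hu.exists_bound_of_ge 0
  obtain ⟨C₂, hC₂, h₂⟩ := hu.exists_negPart_le (M := b * B) (η := η) (by positivity) hη
  obtain ⟨C₃, hC₃, h₃⟩ := hu.exists_mul_rescaled_le (θ := b / (b + δ)) (M := b) (η := η)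
    (by positivity) ((div_lt_one (by positivity)).2 (by linarith)) hb hη
  refine ⟨a * C₁ + C₂ + C₃, by positivity, fun x y => ?_⟩
  have hux := hu.2.1 x
  have hy0 : 0 ≤ η * (max (-y) 0 * u y) :=
    mul_nonneg hη.le (mul_nonneg (le_max_right _ _) (hu.2.1 y))
  have haC : 0 ≤ a * C₁ := by positivity
  rcases le_total 0 x with hx | hx
  · rw [max_eq_right (by linarith : -x ≤ 0), abs_of_nonneg hx]
    have e1 := mul_le_mul_of_nonneg_left (h₁ x hx) ha.le
    have e2 : a * (η / a * x + C₁) = η * x + a * C₁ := by field_simp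
    have e3 : u x * (-y) ≤ B * max (-y) 0 :=
      (mul_le_mul_of_nonneg_left (le_max_left _ _) hux).trans
        (mul_le_mul_of_nonneg_right (hB x hx) (le_max_right _ _))
    have e4 := mul_le_mul_of_nonneg_left e3 hb.le
    have e5 := h₂ y
    linarith
  · rw [max_eq_left (by linarith : 0 ≤ -x)]
    have hηx : 0 ≤ η * |x| := by positivity
    have hxu : 0 ≤ -x * u x := mul_nonneg (by linarith) hux
    rcases le_total 0 y with hy | hy
    · have : 0 ≤ u x * (b * y) := by positivity
      nlinarith
    · rw [max_eq_left (by linarith : 0 ≤ -y)] at hy0 ⊢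
      rcases le_total (b * (-y)) ((b + δ) * (-x)) with h | h
      · have := mul_le_mul_of_nonneg_left h hux
        nlinarith
      · have hxy : b / (b + δ) * y ≤ x := by
          rw [div_mul_eq_mul_div, div_le_iff₀ (by positivity)]
          linarith
        have hmono : u x ≤ u (b / (b + δ) * y) :=
          hu.2.2.1 (mem_Iic.2 (hxy.trans hx)) (mem_Iic.2 hx) hxy
        have e1 := mul_le_mul_of_nonneg_left hmono (mul_nonneg hb.le (neg_nonneg.2 hy))
        have e2 := h₃ y hy
        nlinarith

/-- Summation by parts for the reflection terms of the drift. -/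
lemma sum_driftCoeff_mul {m : ℕ} (μ : Fin m → ℝ) (u : ℝ → ℝ) (a X : ℕ → ℝ)
    (x : EuclideanSpace ℝ (Fin m)) (hX : ∀ i : Fin m, X i = x i) (hXm : X m = 0) :
    ∑ i : Fin m, driftCoeff μ u x i * (a i * x i) =
      ∑ i : Fin m, μ i * (a i * x i) +
        ∑ k ∈ Finset.range m, u (X k) * (a k * X k - a (k + 1) * X (k + 1)) := by
  have h : ∀ i : Fin m, driftCoeff μ u x i * (a i * x i) = μ i * (a i * x i) +
      (u (X i) - if (i : ℕ) = 0 then 0 else u (X ((i : ℕ) - 1))) * (a i * X i) := by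
    intro i
    have hlt : (i : ℕ) - 1 < m := lt_of_le_of_lt (Nat.sub_le _ _) i.isLt
    have := hX ⟨(i : ℕ) - 1, hlt⟩
    simp only at this
    rw [driftCoeff, this, hX i]
    ring
  rw [Finset.sum_congr rfl fun i _ => h i, Finset.sum_add_distrib]
  congr 1
  rw [Fin.sum_univ_eq_sum_range
    (fun k => (u (X k) - if k = 0 then 0 else u (X (k - 1))) * (a k * X k)) m]
  have key : ∀ n, ∑ k ∈ Finset.range n, (u (X k) - if k = 0 then 0 else u (X (k - 1))) *
      (a k * X k) = ∑ k ∈ Finset.range n, u (X k) * (a k * X k - a (k + 1) * X (k + 1)) +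
        (if n = 0 then 0 else u (X (n - 1))) * (a n * X n) := by
    intro n
    induction n with
    | zero => simp
    | succ n ih =>
      rw [Finset.sum_range_succ, ih, Finset.sum_range_succ]
      simp only [Nat.add_sub_cancel, Nat.succ_ne_zero, if_false]
      ring
  rw [key, hXm]
  ring

lemma Admissible.exists_sum_drift_le {m : ℕ} {u : ℝ → ℝ} (hu : Admissible u) (μ : Fin m → ℝ)
    (a : ℕ → ℝ) {δ η κ : ℝ} (hδ : 0 < δ) (hη : 0 < η) (ha1 : ∀ k ≤ m, 1 ≤ a k)
    (ha : ∀ k, a (k + 1) + 2 * δ ≤ a k) (hκ : 0 < κ) (hμ : ∀ i, μ i ≤ -κ) :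
    ∃ C, 0 ≤ C ∧ ∀ x : EuclideanSpace ℝ (Fin m),
      ∑ i : Fin m, driftCoeff μ u x i * (a i * x i) ≤
        -(κ - η) * ∑ i : Fin m, a i * |x i| + C := by
  set ν := min η (δ / 2) with hν
  have hν0 : 0 < ν := lt_min hη (by positivity)
  have hνη : ν ≤ η := min_le_left _ _
  have hνδ : ν ≤ δ / 2 := min_le_right _ _
  have hpair : ∀ k : ℕ, ∃ C, 0 ≤ C ∧ (k < m → ∀ x y, u x * (a k * x - a (k + 1) * y) ≤
      -δ * (max (-x) 0 * u x) + ν * (max (-y) 0 * u y) + ν * |x| + C) := by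
    intro k
    by_cases hk : k < m
    · obtain ⟨C, hC, h⟩ := hu.exists_interaction_le (a := a k) (b := a (k + 1))
        (by linarith [ha1 (k + 1) hk]) hδ (ha k) hν0
      exact ⟨C, hC, fun _ => h⟩
    · exact ⟨0, le_rfl, fun h => absurd h hk⟩
  choose C hC hCx using hpair
  have hneg : ∀ i : Fin m, ∃ D, 0 ≤ D ∧ ∀ y, 2 * (-μ i) * a i * max (-y) 0 ≤
      δ / 2 * (max (-y) 0 * u y) + D := by
    intro i
    have h1 : 0 ≤ -μ i := by linarith [hμ i]
    have h2 : 0 ≤ a i := by linarith [ha1 i i.isLt.le]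
    exact hu.exists_negPart_le (by positivity) (by positivity)
  choose D hD hDx using hneg
  refine ⟨∑ k ∈ Finset.range m, C k + ∑ i, D i,
    add_nonneg (Finset.sum_nonneg fun k _ => hC k) (Finset.sum_nonneg fun i _ => hD i),
    fun x => ?_⟩
  set X : ℕ → ℝ := fun k => if h : k < m then x ⟨k, h⟩ else 0 with hXdef
  have hX : ∀ i : Fin m, X i = x i := fun i => by simp [hXdef]
  have hXm : X m = 0 := by simp [hXdef]
  rw [sum_driftCoeff_mul μ u a X x hX hXm]
  set h : ℝ → ℝ := fun y => max (-y) 0 * u y with hh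
  have hh0 : ∀ y, 0 ≤ h y := fun y => mul_nonneg (le_max_right _ _) (hu.2.1 y)
  have e1 : ∑ k ∈ Finset.range m, u (X k) * (a k * X k - a (k + 1) * X (k + 1)) ≤
      ∑ k ∈ Finset.range m, (-δ * h (X k) + ν * h (X (k + 1)) + ν * |X k| + C k) :=
    Finset.sum_le_sum fun k hk => hCx k (Finset.mem_range.1 hk) _ _
  have e2 : ∑ k ∈ Finset.range m, h (X (k + 1)) ≤ ∑ k ∈ Finset.range m, h (X k) := by
    have t1 := Finset.sum_range_succ (fun k => h (X k)) m
    have t2 := Finset.sum_range_succ' (fun k => h (X k)) m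
    have t3 : h (X m) = 0 := by simp [hh, hXm]
    have t4 := hh0 (X 0)
    linarith
  have e3 : ∑ k ∈ Finset.range m, h (X k) = ∑ i : Fin m, h (x i) := by
    rw [← Fin.sum_univ_eq_sum_range (fun k => h (X k)) m]
    simp only [hX]
  have e4 : ∑ k ∈ Finset.range m, |X k| = ∑ i : Fin m, |x i| := by
    rw [← Fin.sum_univ_eq_sum_range (fun k => |X k|) m]
    simp only [hX]
  simp only [Finset.sum_add_distrib, ← Finset.mul_sum] at e1
  have e5 : 0 ≤ ∑ i : Fin m, h (x i) := Finset.sum_nonneg fun i _ => hh0 _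
  have e6 : ∑ i : Fin m, μ i * (a i * x i) ≤
      ∑ i : Fin m, (-κ * (a i * |x i|) + δ / 2 * h (x i) + D i) := by
    refine Finset.sum_le_sum fun i _ => ?_
    have t1 := hDx i (x i)
    have t2 : x i = |x i| - 2 * max (-(x i)) 0 := by
      rcases le_total 0 (x i) with hx | hx
      · rw [abs_of_nonneg hx, max_eq_right (by linarith)]; ring
      · rw [abs_of_nonpos hx, max_eq_left (by linarith)]; ring
    have ha0 : 0 ≤ a i := by linarith [ha1 i i.isLt.le]
    have t3 : μ i * (a i * |x i|) ≤ -κ * (a i * |x i|) :=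
      mul_le_mul_of_nonneg_right (hμ i) (by positivity)
    have t4 : μ i * (a i * x i) =
        μ i * (a i * |x i|) + 2 * (-μ i) * a i * max (-(x i)) 0 := by
      conv_lhs => rw [t2]
      ring
    rw [t4]
    simp only [hh]
    linarith
  simp only [Finset.sum_add_distrib, ← Finset.mul_sum] at e6
  have e7 : ∑ i : Fin m, |x i| ≤ ∑ i : Fin m, a i * |x i| :=
    Finset.sum_le_sum fun i _ => le_mul_of_one_le_left (abs_nonneg _) (ha1 i i.isLt.le)
  have e8 : 0 ≤ ∑ i : Fin m, |x i| := Finset.sum_nonneg fun i _ => abs_nonneg _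
  rw [e3, e4] at e1
  rw [e3] at e2
  have e9 := mul_le_mul_of_nonneg_left e2 hν0.le
  have e10 := mul_le_mul_of_nonneg_right hνδ e5
  have e11 : ν * ∑ i : Fin m, |x i| ≤ η * ∑ i : Fin m, a i * |x i| :=
    mul_le_mul hνη e7 e8 hη.le
  linarith

/-- A smooth weighted Euclidean norm. -/
def smoothNorm {m : ℕ} (a : ℕ → ℝ) (x : EuclideanSpace ℝ (Fin m)) : ℝ :=
  √(1 + ∑ i : Fin m, a i * x i ^ 2)

section smoothNorm

variable {m : ℕ} {a : ℕ → ℝ}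

lemma one_le_smoothNorm_sq (ha : ∀ i : Fin m, 0 ≤ a i) (x : EuclideanSpace ℝ (Fin m)) :
    1 ≤ 1 + ∑ i : Fin m, a i * x i ^ 2 :=
  le_add_of_nonneg_right (Finset.sum_nonneg fun i _ => mul_nonneg (ha i) (sq_nonneg _))

lemma smoothNorm_sq (ha : ∀ i : Fin m, 0 ≤ a i) (x : EuclideanSpace ℝ (Fin m)) :
    smoothNorm a x ^ 2 = 1 + ∑ i : Fin m, a i * x i ^ 2 :=
  Real.sq_sqrt (zero_le_one.trans (one_le_smoothNorm_sq ha x))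

lemma one_le_smoothNorm (ha : ∀ i : Fin m, 0 ≤ a i) (x : EuclideanSpace ℝ (Fin m)) :
    1 ≤ smoothNorm a x :=
  Real.one_le_sqrt.2 (one_le_smoothNorm_sq ha x)

lemma norm_le_smoothNorm (ha : ∀ i : Fin m, 1 ≤ a i) (x : EuclideanSpace ℝ (Fin m)) :
    ‖x‖ ≤ smoothNorm a x := by
  rw [EuclideanSpace.norm_eq]
  refine Real.sqrt_le_sqrt (le_add_of_nonneg_of_le zero_le_one (Finset.sum_le_sum fun i _ => ?_))
  rw [Real.norm_eq_abs, sq_abs]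
  exact le_mul_of_one_le_left (sq_nonneg _) (ha i)

lemma smoothNorm_le_one_add_sum (ha : ∀ i : Fin m, 1 ≤ a i) (x : EuclideanSpace ℝ (Fin m)) :
    smoothNorm a x ≤ 1 + ∑ i : Fin m, a i * |x i| := by
  have ha0 : ∀ i : Fin m, 0 ≤ a i := fun i => zero_le_one.trans (ha i)
  have h0 : ∀ i ∈ Finset.univ, 0 ≤ a (i : Fin m) * |x i| :=
    fun i _ => mul_nonneg (ha0 i) (abs_nonneg _)
  have hs := Finset.sum_nonneg h0
  refine Real.sqrt_le_iff.2 ⟨by linarith, ?_⟩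
  have h1 : ∑ i : Fin m, a i * x i ^ 2 ≤ ∑ i : Fin m, (a i * |x i|) ^ 2 := by
    refine Finset.sum_le_sum fun i _ => ?_
    rw [mul_pow, sq_abs]
    exact mul_le_mul_of_nonneg_right (by nlinarith [ha i]) (sq_nonneg _)
  have h2 := Finset.sum_sq_le_sq_sum_of_nonneg h0
  nlinarith

lemma contDiff_smoothNorm (ha : ∀ i : Fin m, 0 ≤ a i) :
    ContDiff ℝ 2 (smoothNorm a : EuclideanSpace ℝ (Fin m) → ℝ) := by
  unfold smoothNorm
  refine ContDiff.sqrt ?_ fun x => (zero_lt_one.trans_le (one_le_smoothNorm_sq ha x)).ne'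
  fun_prop

lemma hasFDerivAt_smoothNorm (ha : ∀ i : Fin m, 0 ≤ a i) (x : EuclideanSpace ℝ (Fin m)) :
    HasFDerivAt (smoothNorm a)
      (∑ i : Fin m, (a i * x i / smoothNorm a x) •
        (EuclideanSpace.proj i : EuclideanSpace ℝ (Fin m) →L[ℝ] ℝ)) x := by
  have h1 : HasFDerivAt (fun y : EuclideanSpace ℝ (Fin m) => 1 + ∑ i : Fin m, a i * y i ^ 2)
      (∑ i : Fin m, a i • ((2 * x i) •
        (EuclideanSpace.proj i : EuclideanSpace ℝ (Fin m) →L[ℝ] ℝ))) x := by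
    refine HasFDerivAt.const_add _ (HasFDerivAt.fun_sum fun i _ => HasFDerivAt.const_mul ?_ _)
    have := ((EuclideanSpace.proj i : EuclideanSpace ℝ (Fin m) →L[ℝ] ℝ).hasFDerivAt (x := x)).pow 2
    simpa using this
  have h2 := h1.sqrt (zero_lt_one.trans_le (one_le_smoothNorm_sq ha x)).ne'
  refine h2.congr_fderiv ?_
  rw [Finset.smul_sum]
  refine Finset.sum_congr rfl fun i _ => ?_
  rw [smul_smul, smul_smul]
  congr 1
  change 1 / (2 * smoothNorm a x) * a i * (2 * x i) = _
  have := (zero_lt_one.trans_le (one_le_smoothNorm ha x)).ne'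
  field_simp

lemma fderiv_smoothNorm_single (ha : ∀ i : Fin m, 0 ≤ a i) (x : EuclideanSpace ℝ (Fin m))
    (j : Fin m) :
    fderiv ℝ (smoothNorm a) x (EuclideanSpace.single j 1) = a j * x j / smoothNorm a x := by
  rw [(hasFDerivAt_smoothNorm ha x).fderiv]
  simp

lemma fderiv_exp_smoothNorm_single (ha : ∀ i : Fin m, 0 ≤ a i) (ε : ℝ)
    (x : EuclideanSpace ℝ (Fin m)) (j : Fin m) :
    fderiv ℝ (fun y => exp (ε * smoothNorm a y)) x (EuclideanSpace.single j 1) =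
      ε * exp (ε * smoothNorm a x) * (a j * x j / smoothNorm a x) := by
  have h := hasFDerivAt_smoothNorm ha x
  rw [((h.differentiableAt.hasFDerivAt.const_mul ε).exp).fderiv]
  simp only [smul_apply, smul_eq_mul, fderiv_smoothNorm_single ha]
  ring

lemma fderiv_fderiv_exp_smoothNorm_single (ha : ∀ i : Fin m, 0 ≤ a i) (ε : ℝ)
    (x : EuclideanSpace ℝ (Fin m)) (i j : Fin m) :
    fderiv ℝ (fun y => fderiv ℝ (fun y => exp (ε * smoothNorm a y)) y
        (EuclideanSpace.single j 1)) x (EuclideanSpace.single i 1) =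
      exp (ε * smoothNorm a x) *
        ((ε ^ 2 - ε / smoothNorm a x) *
            ((a i * x i / smoothNorm a x) * (a j * x j / smoothNorm a x)) +
          ε / smoothNorm a x * (if i = j then a j else 0)) := by
  have hq : smoothNorm a x ≠ 0 := (zero_lt_one.trans_le (one_le_smoothNorm ha x)).ne'
  have h := (hasFDerivAt_smoothNorm ha x).differentiableAt.hasFDerivAt
  have hj := (((EuclideanSpace.proj j : EuclideanSpace ℝ (Fin m) →L[ℝ] ℝ).hasFDerivAt
    (x := x)).const_mul (a j))
  have hinv := (hasDerivAt_inv hq).comp_hasFDerivAt x h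
  simp_rw [fderiv_exp_smoothNorm_single ha, div_eq_mul_inv (a j * _)]
  have := ((((h.const_mul ε).exp).const_mul ε).mul (hj.mul hinv)).fderiv
  simp only [Function.comp_def] at this
  erw [this]
  simp [fderiv_smoothNorm_single ha]
  by_cases hij : i = j
  · subst hij
    simp
    field_simp
    ring
  · simp [hij, Ne.symm hij]
    field_simp
    ring

lemma generator_exp_smoothNorm (ha : ∀ i : Fin m, 0 ≤ a i) (ε : ℝ)
    (Γ : Matrix (Fin m) (Fin m) ℝ) (μ : Fin m → ℝ) (u : ℝ → ℝ) (x : EuclideanSpace ℝ (Fin m)) :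
    generator Γ μ u (fun y => exp (ε * smoothNorm a y)) x =
      exp (ε * smoothNorm a x) *
        (1 / 2 * (ε ^ 2 - ε / smoothNorm a x) * ∑ i, ∑ j, Γ i j *
            ((a i * x i / smoothNorm a x) * (a j * x j / smoothNorm a x)) +
          ε / smoothNorm a x * (1 / 2 * ∑ i, Γ i i * a i) +
          ε / smoothNorm a x * ∑ i, driftCoeff μ u x i * (a i * x i)) := by
  unfold generator
  simp only [fderiv_fderiv_exp_smoothNorm_single ha]
  simp only [fderiv_exp_smoothNorm_single ha]
  have h1 : ∀ i j, Γ i j * (exp (ε * smoothNorm a x) * ((ε ^ 2 - ε / smoothNorm a x) *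
        ((a i * x i / smoothNorm a x) * (a j * x j / smoothNorm a x)) +
          ε / smoothNorm a x * (if i = j then a j else 0))) =
      exp (ε * smoothNorm a x) * (ε ^ 2 - ε / smoothNorm a x) *
        (Γ i j * ((a i * x i / smoothNorm a x) * (a j * x j / smoothNorm a x))) +
      exp (ε * smoothNorm a x) * (ε / smoothNorm a x) * (if i = j then Γ i j * a j else 0) := by
    intro i j
    split_ifs <;> ring
  have h2 : ∀ i, driftCoeff μ u x i *
      (ε * exp (ε * smoothNorm a x) * (a i * x i / smoothNorm a x)) =
      exp (ε * smoothNorm a x) * (ε / smoothNorm a x) * (driftCoeff μ u x i * (a i * x i)) := by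
    intro i
    ring
  simp only [h1, h2, Finset.sum_add_distrib, ← Finset.mul_sum, Finset.sum_ite_eq,
    Finset.mem_univ, if_true]
  ring

end smoothNorm

lemma abs_sum_sum_mul_le {ι : Type*} [Fintype ι] (A : Matrix ι ι ℝ) (hA : ∀ i j, A i j = A j i)
    {L : ℝ} (hL : ∀ i, ∑ j, |A i j| ≤ L) (v : ι → ℝ) :
    |∑ i, ∑ j, A i j * (v i * v j)| ≤ L * ∑ i, v i ^ 2 := by
  have h1 : |∑ i, ∑ j, A i j * (v i * v j)| ≤
      ∑ i, ∑ j, (|A i j| * v i ^ 2 / 2 + |A i j| * v j ^ 2 / 2) := by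
    refine (Finset.abs_sum_le_sum_abs _ _).trans (Finset.sum_le_sum fun i _ => ?_)
    refine (Finset.abs_sum_le_sum_abs _ _).trans (Finset.sum_le_sum fun j _ => ?_)
    rw [abs_mul, abs_mul]
    have := mul_le_mul_of_nonneg_left (two_mul_le_add_sq (|v i|) (|v j|)) (abs_nonneg (A i j))
    rw [sq_abs, sq_abs] at this
    linarith
  have h2 : ∑ i, ∑ j, |A i j| * v j ^ 2 / 2 = ∑ i, ∑ j, |A i j| * v i ^ 2 / 2 := by
    rw [Finset.sum_comm]
    exact Finset.sum_congr rfl fun i _ => Finset.sum_congr rfl fun j _ => by rw [hA]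
  have h3 : ∑ i, ∑ j, |A i j| * v i ^ 2 / 2 ≤ L * (∑ i, v i ^ 2) / 2 := by
    rw [mul_div_assoc, Finset.sum_div, Finset.mul_sum]
    refine Finset.sum_le_sum fun i _ => ?_
    simp only [mul_div_assoc]
    rw [← Finset.sum_mul]
    exact mul_le_mul_of_nonneg_right (hL i) (by positivity)
  simp only [Finset.sum_add_distrib] at h1
  linarith

lemma gapGamma_symm (m : ℕ) (i j : Fin m) : gapGamma m i j = gapGamma m j i := by
  simp only [gapGamma, Matrix.of_apply, eq_comm (a := i), or_comm]

lemma sum_abs_gapGamma_le (m : ℕ) (i : Fin m) :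
    ∑ j, |gapGamma m i j| ≤ if m = 1 then 2 else 4 := by
  split_ifs with hm
  · subst hm
    simp [gapGamma, Subsingleton.elim i 0]
  · have h1 : ∀ j, |gapGamma m i j| ≤ (if i = j then 2 else 0) +
        (if (i : ℕ) + 1 = j then 1 else 0) + (if (j : ℕ) + 1 = i then 1 else 0) := by
      intro j
      simp only [gapGamma, Matrix.of_apply]
      split_ifs <;> simp_all
    have h2 : ∀ p : Fin m → Prop, [DecidablePred p] → (∀ j k, p j → p k → j = k) →
        ∑ j, (if p j then (1 : ℝ) else 0) ≤ 1 := by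
      intro p _ hp
      rw [Finset.sum_boole]
      exact_mod_cast Finset.card_le_one.2 fun j hj k hk =>
        hp j k (Finset.mem_filter.1 hj).2 (Finset.mem_filter.1 hk).2
    refine (Finset.sum_le_sum fun j _ => h1 j).trans ?_
    rw [Finset.sum_add_distrib, Finset.sum_add_distrib]
    have e1 := h2 (fun j => (i : ℕ) + 1 = j) fun j k hj hk => Fin.ext (by omega)
    have e2 := h2 (fun j => (j : ℕ) + 1 = i) fun j k hj hk => Fin.ext (by omega)
    have e3 : ∑ j, (if i = j then (2 : ℝ) else 0) = 2 := by simp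
    linarith

lemma lt_mul_one_add_cos_pi_div (m : ℕ) (hm : 1 ≤ m) :
    3 * (if m = 1 then (2 : ℝ) else 4) <
      4 * ((m + 1 : ℕ) : ℝ) * (1 + Real.cos (π / ((m + 1 : ℕ) : ℝ))) := by
  split_ifs with h
  · subst h
    norm_num
  · have h3 : (3 : ℝ) ≤ ((m + 1 : ℕ) : ℝ) := by
      exact_mod_cast (by omega : 3 ≤ m + 1)
    have hcos : 1 / 2 ≤ Real.cos (π / ((m + 1 : ℕ) : ℝ)) := by
      rw [← Real.cos_pi_div_three]
      refine Real.cos_le_cos_of_nonneg_of_le_pi (by positivity) (by linarith [Real.pi_pos]) ?_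
      exact div_le_div_of_nonneg_left Real.pi_pos.le (by norm_num) h3
    nlinarith

/-- The drift condition for `m` gaps between `m + 1` particles. -/
lemma Admissible.exists_gap_drift_condition {m : ℕ} (hm : 1 ≤ m) {u : ℝ → ℝ} (hu : Admissible u)
    (μ : Fin m → ℝ) (hμ : ∀ i, μ i < 0) :
    ∃ b r : ℝ, 0 < r ∧ ∃ V : EuclideanSpace ℝ (Fin m) → ℝ, NormLike V ∧
      ∀ x, generator (gapGamma m) μ u V x ≤
        -((⨅ i, (μ i) ^ 2) / (4 * ((m + 1 : ℕ) : ℝ) *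
          (1 + Real.cos (π / ((m + 1 : ℕ) : ℝ))))) * V x
          + Set.indicator (Metric.closedBall 0 r) (fun _ => b) x := by
  have : Nonempty (Fin m) := ⟨⟨0, hm⟩⟩
  obtain ⟨i₀, hi₀⟩ := exists_eq_ciInf_of_finite (f := fun i => μ i ^ 2)
  rw [← hi₀]
  set κ : ℝ := -μ i₀ with hκdef
  have hκ : 0 < κ := neg_pos.2 (hμ i₀)
  have hμκ : ∀ i, μ i ≤ -κ := by
    intro i
    have h1 : μ i₀ ^ 2 ≤ μ i ^ 2 := hi₀.le.trans (ciInf_le (Set.finite_range _).bddBelow i)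
    have h2 := hμ i
    nlinarith
  set L : ℝ := if m = 1 then 2 else 4 with hL
  have hL0 : 0 < L := by rw [hL]; split_ifs <;> norm_num
  have hm0 : (0 : ℝ) < (m + 1 : ℕ) := by positivity
  set W : ℝ := 4 * ((m + 1 : ℕ) : ℝ) * (1 + Real.cos (π / ((m + 1 : ℕ) : ℝ))) with hW
  have hLW : 3 * L < W := lt_mul_one_add_cos_pi_div m hm
  have hκ2 : μ i₀ ^ 2 = κ ^ 2 := by rw [hκdef, neg_sq]
  rw [hκ2]
  set K : ℝ := κ ^ 2 / W with hK
  have hKlt : K < κ ^ 2 / (3 * L) :=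
    div_lt_div_of_pos_left (by positivity) (by positivity) hLW
  set a : ℕ → ℝ := fun k => 1 + (((m + 1 : ℕ) : ℝ) - k) / (2 * ((m + 1 : ℕ) : ℝ)) with ha
  have ha1 : ∀ k ≤ m, 1 ≤ a k := by
    intro k hk
    have : (k : ℝ) ≤ (m + 1 : ℕ) := by exact_mod_cast hk.trans (Nat.le_succ m)
    exact le_add_of_nonneg_right (div_nonneg (by linarith) (by positivity))
  have ha2 : ∀ k, a k ≤ 3 / 2 := by
    intro k
    have : (((m + 1 : ℕ) : ℝ) - k) / (2 * ((m + 1 : ℕ) : ℝ)) ≤ 1 / 2 := by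
      rw [div_le_div_iff₀ (by positivity) (by norm_num)]
      have : (0 : ℝ) ≤ k := k.cast_nonneg
      linarith
    simp only [ha]
    linarith
  have hastep : ∀ k, a (k + 1) + 2 * (1 / (4 * ((m + 1 : ℕ) : ℝ))) ≤ a k := by
    intro k
    refine le_of_eq ?_
    simp only [ha]
    field_simp
    push_cast
    ring
  have ha1' : ∀ i : Fin m, 1 ≤ a i := fun i => ha1 i i.isLt.le
  have ha0 : ∀ i : Fin m, 0 ≤ a i := fun i => zero_le_one.trans (ha1' i)
  set P : ℝ := 3 / 2 * L with hP
  have hP0 : 0 < P := by positivity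
  set ε : ℝ := κ / P with hε
  have hε0 : 0 < ε := by positivity
  set γ : ℝ := (κ ^ 2 / (3 * L) - K) / 2 with hγ
  have hγ0 : 0 < γ := by rw [hγ]; linarith
  set η : ℝ := min κ (γ / ε) with hη
  have hη0 : 0 < η := lt_min hκ (by positivity)
  have hηκ : η ≤ κ := min_le_left _ _
  have hεη : ε * η ≤ γ := by
    rw [mul_comm, ← le_div_iff₀ hε0]
    exact min_le_right _ _
  obtain ⟨C, hC0, hC⟩ := hu.exists_sum_drift_le μ a (δ := 1 / (4 * ((m + 1 : ℕ) : ℝ)))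
    (by positivity) hη0 ha1 hastep hκ hμκ
  set T : ℝ := 1 / 2 * ∑ i : Fin m, gapGamma m i i * a i with hT
  set E : ℝ := ε * (P / 2 + |T| + κ + C) with hE
  have hE0 : 0 ≤ E := by positivity
  set V : EuclideanSpace ℝ (Fin m) → ℝ := fun y => exp (ε * smoothNorm a y) with hV
  have hVC : ContDiff ℝ 2 V := (contDiff_const.mul (contDiff_smoothNorm ha0)).exp
  have hgen : ∀ x, generator (gapGamma m) μ u V x ≤ V x * (-K - γ + E / smoothNorm a x) := by
    intro x
    rw [hV, generator_exp_smoothNorm ha0]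
    refine mul_le_mul_of_nonneg_left ?_ (exp_pos _).le
    rw [← hT]
    set q := smoothNorm a x with hq
    have hq1 : 1 ≤ q := one_le_smoothNorm ha0 x
    have hq0 : 0 < q := by linarith
    set S := ∑ i, ∑ j, gapGamma m i j * ((a i * x i / q) * (a j * x j / q)) with hS
    have hv : ∑ i : Fin m, (a i * x i / q) ^ 2 ≤ 3 / 2 := by
      have h1 : ∀ i : Fin m, (a i * x i / q) ^ 2 ≤ 3 / 2 * (a i * x i ^ 2) / q ^ 2 := by
        intro i
        rw [div_pow]
        refine div_le_div_of_nonneg_right ?_ (by positivity)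
        have := mul_le_mul_of_nonneg_right (ha2 i) (mul_nonneg (ha0 i) (sq_nonneg (x i)))
        linarith
      refine (Finset.sum_le_sum fun i _ => h1 i).trans ?_
      rw [← Finset.sum_div, ← Finset.mul_sum, div_le_iff₀ (by positivity)]
      have := smoothNorm_sq ha0 x
      rw [← hq] at this
      linarith
    have hSP : |S| ≤ P := by
      refine (abs_sum_sum_mul_le (gapGamma m) (gapGamma_symm m) (sum_abs_gapGamma_le m)
        fun i => a i * x i / q).trans ?_
      have := mul_le_mul_of_nonneg_left hv hL0.le
      rw [← hL]
      linarith
    obtain ⟨hS1, hS2⟩ := abs_le.1 hSP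
    have hD : ∑ i, driftCoeff μ u x i * (a i * x i) ≤ -(κ - η) * q + (κ + C) := by
      have h1 := hC x
      have h2 := mul_le_mul_of_nonneg_left (smoothNorm_le_one_add_sum ha1' x)
        (sub_nonneg.2 hηκ)
      rw [← hq] at h2
      linarith
    have e1 : 1 / 2 * (ε ^ 2 - ε / q) * S ≤ ε ^ 2 * P / 2 + ε / q * (P / 2) := by
      have t1 := mul_le_mul_of_nonneg_left hS2 (sq_nonneg ε)
      have t2 := mul_le_mul_of_nonneg_left hS1 (div_pos hε0 hq0).le
      linarith
    have e2 : ε / q * T ≤ ε / q * |T| :=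
      mul_le_mul_of_nonneg_left (le_abs_self T) (div_pos hε0 hq0).le
    have e3 := mul_le_mul_of_nonneg_left hD (div_pos hε0 hq0).le
    have e4 : ε ^ 2 * P / 2 - ε * κ = -(κ ^ 2 / (3 * L)) := by
      rw [hε, hP]
      field_simp
      ring
    have e5 : ε / q * (-(κ - η) * q + (κ + C)) = -(ε * κ) + ε * η + ε / q * (κ + C) := by
      field_simp
      ring
    have e6 : E / q = ε / q * (P / 2) + ε / q * |T| + ε / q * (κ + C) := by
      rw [hE]
      ring
    have e7 : -K - γ = -(κ ^ 2 / (3 * L)) + γ := by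
      rw [hγ]
      ring
    linarith
  obtain ⟨B, hB⟩ := (isCompact_closedBall (0 : EuclideanSpace ℝ (Fin m))
    (E / γ + 1)).exists_bound_of_continuousOn hVC.continuous.continuousOn
  refine ⟨E * B, E / γ + 1, by positivity, V, ⟨fun x => ?_, hVC, ?_⟩, fun x => ?_⟩
  · have := one_le_smoothNorm ha0 x
    exact one_le_exp (by positivity)
  · refine tendsto_exp_atTop.comp (Tendsto.const_mul_atTop hε0 ?_)
    exact tendsto_atTop_mono (norm_le_smoothNorm ha1') tendsto_comap
  · have hq1 := one_le_smoothNorm ha0 x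
    have hq0 : 0 < smoothNorm a x := by linarith
    have hV0 : 0 < V x := exp_pos _
    refine (hgen x).trans ?_
    by_cases hx : x ∈ Metric.closedBall (0 : EuclideanSpace ℝ (Fin m)) (E / γ + 1)
    · rw [Set.indicator_of_mem hx]
      have h1 : E / smoothNorm a x ≤ E := div_le_self hE0 hq1
      have h2 : V x ≤ B := (le_abs_self _).trans (hB x hx)
      have h3 := mul_le_mul_of_nonneg_left h2 hE0
      have h4 := mul_le_mul_of_nonneg_left h1 hV0.le
      have h5 := mul_pos hV0 hγ0
      linarith
    · rw [Set.indicator_of_notMem hx, add_zero]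
      have h1 : E / γ + 1 < ‖x‖ := by simpa using hx
      have h2 := norm_le_smoothNorm ha1' x
      have h3 : E / smoothNorm a x ≤ γ := by
        rw [div_le_iff₀ hq0, mul_comm, ← div_le_iff₀ hγ0]
        linarith
      have h4 := mul_le_mul_of_nonneg_left h3 hV0.le
      linarith

/-- Exponential drift condition for the gap process of `d` Brownian particles with soft
reflection (Proposition 4.1), with rate `K^s = min_i μ̃_i² / (4d(1 + cos(π/d)))`. -/
theorem soft_reflection_gap_drift_condition (d : ℕ) (hd : 2 ≤ d)
    (μ : Fin (d - 1) → ℝ) (hμ : ∀ i, μ i < 0) (u : ℝ → ℝ) (hu : Admissible u) :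
    ∃ b r : ℝ, 0 < r ∧ ∃ V : EuclideanSpace ℝ (Fin (d - 1)) → ℝ, NormLike V ∧
      ∀ x, generator (gapGamma (d - 1)) μ u V x ≤
        -((⨅ i, (μ i) ^ 2) / (4 * d * (1 + Real.cos (π / d)))) * V x
          + Set.indicator (Metric.closedBall 0 r) (fun _ => b) x := by
  obtain ⟨m, rfl⟩ : ∃ m, d = m + 1 := ⟨d - 1, by omega⟩
  exact hu.exists_gap_drift_condition (by omega : 1 ≤ m) μ hμ
end
end
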